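/- arXiv:1403.3760 — 3 statements merged into one kernel-verified Lean document; each statement's English description precedes it below -/
import Mathlib

section
/- Comparison Principle (Theorem 3.4). Let U ⊆ ℝⁿ (n ≥ 1) be a bounded open set. Suppose (u₁, u₂) and (v₁, v₂) are pairs of continuous real functions on the closure of U such that (u₁, u₂) is a viscosity subsolution and (v₁, v₂) is a viscosity supersolution of the system −Δ∞u₁ + u₁ − u₂ = 0, −Δ∞u₂ + u₂ − u₁ = 0 in U, and u_i ≤ v_i on ∂U for i = 1, 2. Then u_i ≤ v_i on the closure of U for i = 1, 2. -/
open Filter Metric Set Topology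

noncomputable def secondDeriv {n : ℕ} (φ : EuclideanSpace ℝ (Fin n) → ℝ)
    (x v : EuclideanSpace ℝ (Fin n)) : ℝ :=
  iteratedFDeriv ℝ 2 φ x ![v, v]

open scoped Classical in
noncomputable def laplInfPlus {n : ℕ} (φ : EuclideanSpace ℝ (Fin n) → ℝ)
    (x : EuclideanSpace ℝ (Fin n)) : ℝ :=
  if gradient φ x = 0 then
    sSup {t : ℝ | ∃ v : EuclideanSpace ℝ (Fin n), ‖v‖ = 1 ∧ t = secondDeriv φ x v}
  else secondDeriv φ x (gradient φ x) / ‖gradient φ x‖ ^ 2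

open scoped Classical in
noncomputable def laplInfMinus {n : ℕ} (φ : EuclideanSpace ℝ (Fin n) → ℝ)
    (x : EuclideanSpace ℝ (Fin n)) : ℝ :=
  if gradient φ x = 0 then
    sInf {t : ℝ | ∃ v : EuclideanSpace ℝ (Fin n), ‖v‖ = 1 ∧ t = secondDeriv φ x v}
  else secondDeriv φ x (gradient φ x) / ‖gradient φ x‖ ^ 2

/-- One half of the subsolution condition: `-Δ∞⁺φ(x₀) + u(x₀) - v(x₀) ≤ 0` at
local maximum points of `u - φ`. -/
def SubPair {n : ℕ} (U : Set (EuclideanSpace ℝ (Fin n)))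
    (u v : EuclideanSpace ℝ (Fin n) → ℝ) : Prop :=
  ∀ φ : EuclideanSpace ℝ (Fin n) → ℝ, ContDiff ℝ 2 φ →
    ∀ x₀ ∈ U, IsLocalMaxOn (fun x => u x - φ x) U x₀ →
      -laplInfPlus φ x₀ + u x₀ - v x₀ ≤ 0

def SuperPair {n : ℕ} (U : Set (EuclideanSpace ℝ (Fin n)))
    (u v : EuclideanSpace ℝ (Fin n) → ℝ) : Prop :=
  ∀ φ : EuclideanSpace ℝ (Fin n) → ℝ, ContDiff ℝ 2 φ →
    ∀ x₀ ∈ U, IsLocalMinOn (fun x => u x - φ x) U x₀ →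
      0 ≤ -laplInfMinus φ x₀ + u x₀ - v x₀

/-- `(u₁, u₂)` is a viscosity subsolution of the system
`-Δ∞u₁ + u₁ - u₂ = 0`, `-Δ∞u₂ + u₂ - u₁ = 0` in `U`. -/
def IsSubsolution {n : ℕ} (U : Set (EuclideanSpace ℝ (Fin n)))
    (u₁ u₂ : EuclideanSpace ℝ (Fin n) → ℝ) : Prop :=
  UpperSemicontinuousOn u₁ U ∧ UpperSemicontinuousOn u₂ U ∧
    SubPair U u₁ u₂ ∧ SubPair U u₂ u₁

/-- `(u₁, u₂)` is a viscosity supersolution of the system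
`-Δ∞u₁ + u₁ - u₂ = 0`, `-Δ∞u₂ + u₂ - u₁ = 0` in `U`. -/
def IsSupersolution {n : ℕ} (U : Set (EuclideanSpace ℝ (Fin n)))
    (u₁ u₂ : EuclideanSpace ℝ (Fin n) → ℝ) : Prop :=
  LowerSemicontinuousOn u₁ U ∧ LowerSemicontinuousOn u₂ U ∧
    SuperPair U u₁ u₂ ∧ SuperPair U u₂ u₁

def IsSolution {n : ℕ} (U : Set (EuclideanSpace ℝ (Fin n)))
    (u₁ u₂ : EuclideanSpace ℝ (Fin n) → ℝ) : Prop :=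
  IsSubsolution U u₁ u₂ ∧ IsSupersolution U u₁ u₂

/-- First component of the generalized cone pair with vertex `x₀`. -/
noncomputable def cone₁ {n : ℕ} (x₀ : EuclideanSpace ℝ (Fin n)) (C₁ C₂ a b : ℝ)
    (x : EuclideanSpace ℝ (Fin n)) : ℝ :=
  C₁ * Real.exp (Real.sqrt 2 * ‖x - x₀‖) + C₂ * Real.exp (-(Real.sqrt 2 * ‖x - x₀‖)) +
    a * ‖x - x₀‖ + b

/-- Second component of the generalized cone pair with vertex `x₀`. -/
noncomputable def cone₂ {n : ℕ} (x₀ : EuclideanSpace ℝ (Fin n)) (C₁ C₂ a b : ℝ)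
    (x : EuclideanSpace ℝ (Fin n)) : ℝ :=
  -C₁ * Real.exp (Real.sqrt 2 * ‖x - x₀‖) - C₂ * Real.exp (-(Real.sqrt 2 * ‖x - x₀‖)) +
    a * ‖x - x₀‖ + b

noncomputable def sphMax {n : ℕ} (u : EuclideanSpace ℝ (Fin n) → ℝ)
    (x₀ : EuclideanSpace ℝ (Fin n)) (r : ℝ) : ℝ :=
  sSup (u '' sphere x₀ r)

noncomputable def sphMin {n : ℕ} (u : EuclideanSpace ℝ (Fin n) → ℝ)
    (x₀ : EuclideanSpace ℝ (Fin n)) (r : ℝ) : ℝ :=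
  sInf (u '' sphere x₀ r)

noncomputable def Splus {n : ℕ} (u : EuclideanSpace ℝ (Fin n) → ℝ)
    (x₀ : EuclideanSpace ℝ (Fin n)) (r : ℝ) : ℝ :=
  (sphMax u x₀ r - u x₀) / r

noncomputable def Sminus {n : ℕ} (u : EuclideanSpace ℝ (Fin n) → ℝ)
    (x₀ : EuclideanSpace ℝ (Fin n)) (r : ℝ) : ℝ :=
  (sphMin u x₀ r - u x₀) / r


theorem exists_contDiff_eventuallyEq {E : Type*} [NormedAddCommGroup E] [InnerProductSpace ℝ E]
    [FiniteDimensional ℝ E] {f : E → ℝ} {z : E} (hf : ContDiffAt ℝ 2 f z) :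
    ∃ φ : E → ℝ, ContDiff ℝ 2 φ ∧ φ =ᶠ[𝓝 z] f := by
  obtain ⟨R, hR, hfR⟩ := Metric.eventually_nhds_iff_ball.1 (hf.eventually (by simp))
  let χ : ContDiffBump z := ⟨R / 3, R / 2, by positivity, by linarith⟩
  refine ⟨fun x => χ x * f x, contDiff_iff_contDiffAt.2 fun x => ?_, ?_⟩
  · by_cases hx : x ∈ ball z R
    · exact χ.contDiffAt.mul (hfR x hx)
    · have hx' : x ∉ tsupport χ := by
        rw [χ.tsupport_eq]
        intro h
        apply hx
        have : dist x z ≤ R / 2 := h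
        rw [mem_ball]; linarith
      have h0 : (fun x => χ x * f x) =ᶠ[𝓝 x] fun _ => 0 := by
        filter_upwards [notMem_tsupport_iff_eventuallyEq.1 hx'] with y hy
        simp [hy]
      exact contDiffAt_const.congr_of_eventuallyEq h0
  · filter_upwards [χ.eventuallyEq_one] with y hy
    simp [hy]

theorem hasFDerivAt_norm_sub {E : Type*} [NormedAddCommGroup E] [InnerProductSpace ℝ E]
    {x y : E} (hxy : x ≠ y) :
    HasFDerivAt (fun x : E => ‖x - y‖) (innerSL ℝ (‖x - y‖⁻¹ • (x - y))) x := by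
  have hpos : 0 < ‖x - y‖ := norm_pos_iff.2 (sub_ne_zero.2 hxy)
  have h1 : HasFDerivAt (fun x : E => ‖x - y‖ ^ 2) (2 • (innerSL ℝ (x - y))) x := by
    simpa using ((hasFDerivAt_id x).sub_const y).norm_sq
  have h2 := h1.sqrt (by positivity)
  simp only [Real.sqrt_sq (norm_nonneg _)] at h2
  convert h2 using 1
  ext v
  simp
  field_simp

theorem radial_derivatives {n : ℕ} {φ : EuclideanSpace ℝ (Fin n) → ℝ}
    {z y : EuclideanSpace ℝ (Fin n)} {h h' : ℝ → ℝ} {h'' : ℝ} (hzy : z ≠ y)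
    (hφ : ContDiff ℝ 2 φ) (heq : φ =ᶠ[𝓝 z] fun x => h ‖x - y‖)
    (hh : ∀ᶠ t in 𝓝 ‖z - y‖, HasDerivAt h (h' t) t) (hh' : HasDerivAt h' h'' ‖z - y‖) :
    gradient φ z = h' ‖z - y‖ • (‖z - y‖⁻¹ • (z - y)) ∧
      secondDeriv φ z (‖z - y‖⁻¹ • (z - y)) = h'' := by
  set ρ := ‖z - y‖ with hρ
  have hpos : 0 < ρ := norm_pos_iff.2 (sub_ne_zero.2 hzy)
  set e := ρ⁻¹ • (z - y) with he
  have hzy' : z - y = ρ • e := by rw [he, smul_smul, mul_inv_cancel₀ hpos.ne', one_smul]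
  have hen : ‖e‖ = 1 := by
    rw [he, norm_smul, norm_inv, Real.norm_of_nonneg hpos.le, ← hρ, inv_mul_cancel₀ hpos.ne']
  have hfd : ∀ᶠ x in 𝓝 z, HasFDerivAt φ (h' ‖x - y‖ • innerSL ℝ (‖x - y‖⁻¹ • (x - y))) x := by
    have hc : Tendsto (fun x => ‖x - y‖) (𝓝 z) (𝓝 ρ) :=
      (by fun_prop : Continuous fun x => ‖x - y‖).tendsto z
    filter_upwards [heq.eventuallyEq_nhds, hc.eventually hh, eventually_ne_nhds hzy]
      with x hx1 hx2 hx3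
    exact (hx2.comp_hasFDerivAt x (hasFDerivAt_norm_sub hx3)).congr_of_eventuallyEq hx1
  constructor
  · have h1 := hfd.self_of_nhds
    have h2 : HasGradientAt φ (h' ρ • e) z := by
      have h3 : InnerProductSpace.toDual ℝ (EuclideanSpace ℝ (Fin n)) (h' ρ • e) =
          h' ρ • innerSL ℝ e := by
        ext v
        simp
      rw [hasGradientAt_iff_hasFDerivAt, h3]
      exact h1
    exact h2.gradient
  · have hline : Tendsto (fun t : ℝ => z + t • e) (𝓝 0) (𝓝 z) := by
      have : Continuous fun t : ℝ => z + t • e := by fun_prop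
      simpa using this.tendsto 0
    have h1 : (fun t : ℝ => fderiv ℝ φ (z + t • e) e) =ᶠ[𝓝 0] fun t => h' (ρ + t) := by
      filter_upwards [hline.eventually hfd, lt_mem_nhds (neg_lt_zero.2 hpos)] with t ht ht0
      have hzt : z + t • e - y = (ρ + t) • e := by
        rw [add_smul, ← hzy']; abel
      have hn : ‖(ρ + t) • e‖ = ρ + t := by
        rw [norm_smul, hen, mul_one, Real.norm_of_nonneg (by linarith)]
      rw [ht.fderiv, hzt, hn, smul_smul, inv_mul_cancel₀ (by linarith), one_smul]
      simp [hen]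
    have h2 : HasDerivAt (fun t : ℝ => fderiv ℝ φ (z + t • e) e) h'' 0 := by
      refine HasDerivAt.congr_of_eventuallyEq ?_ h1
      have h3 : HasDerivAt h' h'' (ρ + 0) := by simpa using hh'
      exact h3.comp_const_add ρ 0
    have h3 : HasDerivAt (fun t : ℝ => fderiv ℝ φ (z + t • e) e)
        (fderiv ℝ (fderiv ℝ φ) z e e) 0 := by
      have hd : HasFDerivAt (fderiv ℝ φ) (fderiv ℝ (fderiv ℝ φ) z) (z + (0 : ℝ) • e) := by
        rw [zero_smul, add_zero]
        exact ((hφ.fderiv_right (m := 1) (by norm_num)).differentiable (by norm_num) z).hasFDerivAt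
      have hl : HasDerivAt (fun t : ℝ => z + t • e) e 0 := by
        simpa using ((hasDerivAt_id (0 : ℝ)).smul_const e).const_add z
      have := hd.comp_hasDerivAt (0 : ℝ) hl
      simpa using this.clm_apply (hasDerivAt_const (0 : ℝ) e)
    rw [secondDeriv, iteratedFDeriv_two_apply]
    simpa using h3.unique h2

/-- The part of the subsolution condition that is used below: tests by constants, and tests by
functions whose gradient does not vanish. Unlike `SubPair`, it is preserved when a supersolution
is replaced by its negative. -/
def WeakSubPair {n : ℕ} (U : Set (EuclideanSpace ℝ (Fin n)))
    (u v : EuclideanSpace ℝ (Fin n) → ℝ) : Prop :=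
  (∀ x ∈ U, IsLocalMax u x → u x ≤ v x) ∧
    ∀ φ : EuclideanSpace ℝ (Fin n) → ℝ, ContDiff ℝ 2 φ → ∀ x ∈ U,
      IsLocalMax (fun y => u y - φ y) x → gradient φ x ≠ 0 →
        u x - v x ≤ secondDeriv φ x (gradient φ x) / ‖gradient φ x‖ ^ 2

theorem secondDeriv_const {n : ℕ} (c : ℝ) (x v : EuclideanSpace ℝ (Fin n)) :
    secondDeriv (fun _ => c) x v = 0 := by
  simp [secondDeriv, iteratedFDeriv_two_apply]

theorem secondDeriv_neg {n : ℕ} (φ : EuclideanSpace ℝ (Fin n) → ℝ)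
    (x v : EuclideanSpace ℝ (Fin n)) :
    secondDeriv (fun y => -φ y) x (-v) = -secondDeriv φ x v := by
  have : fderiv ℝ (fun y => -φ y) = fun y => -fderiv ℝ φ y := by
    ext1 y; exact fderiv_fun_neg
  simp [secondDeriv, iteratedFDeriv_two_apply, this]

theorem secondDeriv_smul {n : ℕ} (φ : EuclideanSpace ℝ (Fin n) → ℝ)
    (x v : EuclideanSpace ℝ (Fin n)) (c : ℝ) :
    secondDeriv φ x (c • v) = c ^ 2 * secondDeriv φ x v := by
  simp [secondDeriv, iteratedFDeriv_two_apply]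
  ring

theorem gradient_neg_fun {n : ℕ} (φ : EuclideanSpace ℝ (Fin n) → ℝ)
    (x : EuclideanSpace ℝ (Fin n)) : gradient (fun y => -φ y) x = -gradient φ x := by
  simp [gradient]

theorem sSup_eq_zero_of_forall {S : Set ℝ} (hS : ∀ t ∈ S, t = 0) : sSup S = 0 :=
  le_antisymm (Real.sSup_nonpos fun t ht => (hS t ht).le) (Real.sSup_nonneg fun t ht => (hS t ht).ge)

theorem sInf_eq_zero_of_forall {S : Set ℝ} (hS : ∀ t ∈ S, t = 0) : sInf S = 0 :=
  le_antisymm (Real.sInf_nonpos fun t ht => (hS t ht).le) (Real.sInf_nonneg fun t ht => (hS t ht).ge)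

theorem SubPair.weakSubPair {n : ℕ} {U : Set (EuclideanSpace ℝ (Fin n))}
    {u v : EuclideanSpace ℝ (Fin n) → ℝ} (h : SubPair U u v) : WeakSubPair U u v := by
  constructor
  · intro x hx hmax
    have h1 := h (fun _ => 0) contDiff_const x hx (by simpa using hmax.on U)
    have h2 : laplInfPlus (fun _ : EuclideanSpace ℝ (Fin n) => (0 : ℝ)) x = 0 := by
      rw [laplInfPlus, if_pos (by simp [gradient])]
      refine sSup_eq_zero_of_forall ?_
      rintro t ⟨v, -, rfl⟩
      exact secondDeriv_const 0 x v
    linarith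
  · intro φ hφ x hx hmax hg
    have h1 := h φ hφ x hx (hmax.on U)
    rw [laplInfPlus, if_neg hg] at h1
    linarith

theorem SuperPair.weakSubPair_neg {n : ℕ} {U : Set (EuclideanSpace ℝ (Fin n))}
    {u v : EuclideanSpace ℝ (Fin n) → ℝ} (h : SuperPair U u v) :
    WeakSubPair U (fun x => -u x) (fun x => -v x) := by
  constructor
  · intro x hx hmax
    have h1 := h (fun _ => 0) contDiff_const x hx (by simpa using hmax.neg.on U)
    have h2 : laplInfMinus (fun _ : EuclideanSpace ℝ (Fin n) => (0 : ℝ)) x = 0 := by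
      rw [laplInfMinus, if_pos (by simp [gradient])]
      refine sInf_eq_zero_of_forall ?_
      rintro t ⟨v, -, rfl⟩
      exact secondDeriv_const 0 x v
    linarith
  · intro φ hφ x hx hmax hg
    have hmin : IsLocalMin (fun y => u y - -φ y) x := by
      have := hmax.neg
      refine this.congr (Eventually.of_forall fun y => ?_)
      simp only []; ring
    have h1 := h (fun y => -φ y) hφ.neg x hx (hmin.on U)
    rw [laplInfMinus, gradient_neg_fun, if_neg (by simpa using hg), norm_neg,
      secondDeriv_neg φ x, neg_div] at h1
    linarith

theorem WeakSubPair.radial_test {n : ℕ} {U : Set (EuclideanSpace ℝ (Fin n))}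
    {u v : EuclideanSpace ℝ (Fin n) → ℝ} (H : WeakSubPair U u v)
    {z y : EuclideanSpace ℝ (Fin n)} {h h' : ℝ → ℝ} {h'' : ℝ} (hz : z ∈ U) (hzy : z ≠ y)
    (hC : ContDiffAt ℝ 2 h ‖z - y‖) (hmax : IsLocalMax (fun x => u x - h ‖x - y‖) z)
    (hh : ∀ᶠ t in 𝓝 ‖z - y‖, HasDerivAt h (h' t) t) (hh' : HasDerivAt h' h'' ‖z - y‖)
    (hne : h' ‖z - y‖ ≠ 0) : u z - v z ≤ h'' := by
  have hpos : 0 < ‖z - y‖ := norm_pos_iff.2 (sub_ne_zero.2 hzy)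
  have hf : ContDiffAt ℝ 2 (fun x => h ‖x - y‖) z :=
    hC.comp z ((contDiffAt_id.sub contDiffAt_const).norm ℝ (sub_ne_zero.2 hzy))
  obtain ⟨φ, hφ, heq⟩ := exists_contDiff_eventuallyEq hf
  obtain ⟨hg, hs⟩ := radial_derivatives hzy hφ heq hh hh'
  have hen : ‖‖z - y‖⁻¹ • (z - y)‖ = 1 := by
    rw [norm_smul, norm_inv, norm_norm, inv_mul_cancel₀ hpos.ne']
  have h1 := H.2 φ hφ z hz (hmax.congr (heq.mono fun x hx => by simp [hx])) (by
    rw [hg]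
    intro h0
    have := congrArg norm h0
    rw [norm_smul, hen, mul_one, norm_zero, norm_eq_zero] at this
    exact hne this)
  rwa [hg, secondDeriv_smul, hs, norm_smul, hen, mul_one, Real.norm_eq_abs, sq_abs,
    mul_div_cancel_left₀ _ (pow_ne_zero 2 hne)] at h1

/-- Test by functions `a ‖x - y‖ + b / 2 * ‖x - y‖ ^ 2` for the equation satisfied by the
exponentials of a subsolution; the term `(a + b ‖z - y‖) ^ 2 / W z` makes it strict where the
gradient does not vanish. -/
def ConeTest {n : ℕ} (U : Set (EuclideanSpace ℝ (Fin n)))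
    (W V : EuclideanSpace ℝ (Fin n) → ℝ) : Prop :=
  ∀ z ∈ U, ∀ y, z ≠ y → ∀ a b : ℝ, a + b * ‖z - y‖ ≠ 0 →
    IsLocalMax (fun x => W x - (a * ‖x - y‖ + b / 2 * ‖x - y‖ ^ 2)) z →
      W z - V z + (a + b * ‖z - y‖) ^ 2 / W z ≤ b

theorem WeakSubPair.coneTest_exp {n : ℕ} {U : Set (EuclideanSpace ℝ (Fin n))}
    {u v : EuclideanSpace ℝ (Fin n) → ℝ} (H : WeakSubPair U u v) {δ : ℝ} (hδ : 0 < δ) :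
    ConeTest U (fun x => Real.exp (δ * u x)) (fun x => Real.exp (δ * v x)) := by
  intro z hz y hzy a b hs hmax
  set P := Real.exp (δ * u z) with hP
  have hPpos : 0 < P := Real.exp_pos _
  set ρ := ‖z - y‖ with hρ
  set s := a + b * ρ with hsdef
  let q : ℝ → ℝ := fun t => a * t + b / 2 * t ^ 2 + (P - (a * ρ + b / 2 * ρ ^ 2))
  have hqρ : q ρ = P := by simp [q]
  have hqc : Continuous q := by fun_prop
  have hq : ∀ t, HasDerivAt q (a + b * t) t := fun t => by
    have := (((hasDerivAt_id t).const_mul a).add ((hasDerivAt_pow 2 t).const_mul (b / 2))).add_const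
      (P - (a * ρ + b / 2 * ρ ^ 2))
    refine this.congr_deriv ?_
    simp; ring
  have hqpos : ∀ᶠ t in 𝓝 ρ, 0 < q t :=
    hqc.continuousAt.eventually (lt_mem_nhds (by rw [hqρ]; exact hPpos))
  have hlin : HasDerivAt (fun t => a + b * t) b ρ := by
    simpa using ((hasDerivAt_id ρ).const_mul b).const_add a
  have key := H.radial_test (h := fun t => Real.log (q t) / δ)
    (h' := fun t => (a + b * t) / q t / δ) (h'' := (b * P - s * s) / P ^ 2 / δ) hz hzy ?_ ?_ ?_ ?_ ?_
  · have h1 : 1 + δ * (v z - u z) ≤ Real.exp (δ * (v z - u z)) := by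
      linarith [Real.add_one_le_exp (δ * (v z - u z))]
    have h2 : P * Real.exp (δ * (v z - u z)) = Real.exp (δ * v z) := by
      rw [hP, ← Real.exp_add]; congr 1; ring
    have h3 : P * (1 + δ * (v z - u z)) ≤ Real.exp (δ * v z) := by
      rw [← h2]; gcongr
    have h4 : (b * P - s * s) / P ^ 2 / δ = (b - s ^ 2 / P) / (P * δ) := by
      field_simp
    rw [h4, le_div_iff₀ (by positivity)] at key
    nlinarith
  · have hqd : ContDiff ℝ 2 q := by fun_prop
    exact (hqd.contDiffAt.log (by rw [← hρ, hqρ]; exact hPpos.ne')).div_const δ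
  · have hc : Tendsto (fun x => ‖x - y‖) (𝓝 z) (𝓝 ρ) :=
      (by fun_prop : Continuous fun x => ‖x - y‖).tendsto z
    filter_upwards [hmax, hc.eventually hqpos] with x hx hx'
    have h1 : Real.exp (δ * u x) ≤ q ‖x - y‖ := by
      simp only [← hρ, ← hP] at hx
      simp only [q]; linarith
    have h2 : δ * u x ≤ Real.log (q ‖x - y‖) := (Real.le_log_iff_exp_le hx').2 h1
    have h3 : Real.log (q ρ) = δ * u z := by rw [hqρ, hP, Real.log_exp]
    simp only [← hρ]
    rw [h3, mul_div_cancel_left₀ _ hδ.ne', sub_self, sub_nonpos, le_div_iff₀ hδ]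
    linarith
  · filter_upwards [hqpos] with t ht
    exact ((hq t).log ht.ne').div_const δ
  · have := (hlin.fun_div (hq ρ) (by rw [hqρ]; exact hPpos.ne')).div_const δ
    rwa [hqρ] at this
  · simp only [← hρ, hqρ, ← hsdef]
    positivity

theorem exists_isLocalMax_sub_cone {n : ℕ} {W : EuclideanSpace ℝ (Fin n) → ℝ}
    {y x₀ : EuclideanSpace ℝ (Fin n)} {R a b B : ℝ} (hW : ContinuousOn W (closedBall y R))
    (hy : W y ≤ B) (hR : ∀ x, ‖x - y‖ = R → W x ≤ B + a * R + b / 2 * R ^ 2)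
    (hx₀ : ‖x₀ - y‖ ≤ R) (hx₀W : B + a * ‖x₀ - y‖ + b / 2 * ‖x₀ - y‖ ^ 2 < W x₀) :
    ∃ z, z ≠ y ∧ ‖z - y‖ < R ∧ B + a * ‖z - y‖ + b / 2 * ‖z - y‖ ^ 2 < W z ∧
      IsLocalMax (fun x => W x - (a * ‖x - y‖ + b / 2 * ‖x - y‖ ^ 2)) z := by
  have hc : ContinuousOn (fun x => W x - (a * ‖x - y‖ + b / 2 * ‖x - y‖ ^ 2)) (closedBall y R) :=
    hW.sub (by fun_prop)
  have hx₀mem : x₀ ∈ closedBall y R := by rwa [mem_closedBall, dist_eq_norm]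
  obtain ⟨z, hz, hmax⟩ := (isCompact_closedBall y R).exists_isMaxOn ⟨x₀, hx₀mem⟩ hc
  have h1 : B + a * ‖z - y‖ + b / 2 * ‖z - y‖ ^ 2 < W z := by
    have : W x₀ - _ ≤ W z - _ := hmax hx₀mem
    linarith
  have hzR : ‖z - y‖ < R := by
    rw [mem_closedBall, dist_eq_norm] at hz
    refine lt_of_le_of_ne hz fun h => ?_
    have := hR z h
    rw [h] at h1
    linarith
  refine ⟨z, ?_, hzR, h1, hmax.isLocalMax ?_⟩
  · rintro rfl
    simp at h1
    linarith
  · exact mem_of_superset (isOpen_ball.mem_nhds (by rwa [mem_ball, dist_eq_norm]))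
      ball_subset_closedBall

/-- Strong maximum principle. -/
theorem ConeTest.eq_of_le {n : ℕ} {U : Set (EuclideanSpace ℝ (Fin n))}
    {W V : EuclideanSpace ℝ (Fin n) → ℝ} (H : ConeTest U W V) (hpos : ∀ x, 0 < W x)
    {x₀ : EuclideanSpace ℝ (Fin n)} {r : ℝ} (hr1 : r ≤ 1)
    (hU : ball x₀ r ⊆ U) (hW : ContinuousOn W U)
    (hWm : ∀ x ∈ ball x₀ r, W x ≤ W x₀) (hVm : ∀ x ∈ ball x₀ r, V x ≤ W x₀)
    {y : EuclideanSpace ℝ (Fin n)} (hy : y ∈ ball x₀ (r / 2)) : W y = W x₀ := by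
  rw [mem_ball, dist_eq_norm] at hy
  have hr : 0 < r := by linarith [norm_nonneg (y - x₀)]
  by_contra hne
  have hyr : y ∈ ball x₀ r := by rw [mem_ball, dist_eq_norm]; linarith
  set R := r / 2 with hRdef
  have hR0 : 0 < R := by positivity
  have hR1 : R < 1 := by linarith
  have hη : 0 < W x₀ - W y := sub_pos.2 (lt_of_le_of_ne (hWm y hyr) hne)
  set η := W x₀ - W y with hηdef
  have hball : closedBall y R ⊆ ball x₀ r := closedBall_subset_ball' (by rw [dist_eq_norm]; linarith)
  have hρ : ‖x₀ - y‖ < R := by rwa [norm_sub_rev]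
  have haR : (η / R + η * R) * R = η + η * R ^ 2 := by field_simp
  have hslope : 0 < η / R + η * R - 2 * η * R := by
    have : η / R + η * R - 2 * η * R = η * (1 - R ^ 2) / R := by field_simp; ring
    rw [this]
    have : R ^ 2 < 1 := by nlinarith
    have : 0 < 1 - R ^ 2 := by linarith
    positivity
  set a := η / R + η * R with hadef
  obtain ⟨z, hzy, hzR, hzW, hmax⟩ := exists_isLocalMax_sub_cone (W := W) (y := y) (x₀ := x₀)
    (R := R) (a := a) (b := -2 * η) (B := W y) (hW.mono (hball.trans hU)) le_rfl
    (fun x hx => by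
      have := hWm x (hball (by rw [mem_closedBall, dist_eq_norm, hx]))
      nlinarith) hρ.le (by
      nlinarith [mul_pos (sub_pos.2 hρ) hslope, mul_pos hη (sub_pos.2 hρ),
        mul_pos (mul_pos hη (sub_pos.2 hρ)) (sub_pos.2 hρ), norm_nonneg (x₀ - y)])
  have hzball : z ∈ ball x₀ r := hball (by rw [mem_closedBall, dist_eq_norm]; exact hzR.le)
  have hz0 : 0 < ‖z - y‖ := norm_pos_iff.2 (sub_ne_zero.2 hzy)
  have hsl : 0 < a + -2 * η * ‖z - y‖ := by nlinarith [mul_pos hη (sub_pos.2 hzR)]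
  have h1 := H z (hU hzball) y hzy a (-2 * η) hsl.ne' hmax
  have h2 : 0 ≤ (a + -2 * η * ‖z - y‖) ^ 2 / W z := div_nonneg (sq_nonneg _) (hpos z).le
  have h3 := hVm z hzball
  have h4 : 0 < ‖z - y‖ * (a - η * ‖z - y‖) := mul_pos hz0 (by nlinarith)
  nlinarith

theorem ConeTest.eventually_le_midpoint {n : ℕ} {U : Set (EuclideanSpace ℝ (Fin n))}
    {W V : EuclideanSpace ℝ (Fin n) → ℝ} (H : ConeTest U W V) (hpos : ∀ x, 0 < W x)
    (hU : IsOpen U) (hW : ContinuousOn W U) (hV : ContinuousOn V U)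
    {x' : EuclideanSpace ℝ (Fin n)} (hx' : x' ∈ U) {κ : ℝ} (hκ : 0 < κ) :
    ∃ η > 0, ∀ᶠ ε in 𝓝[>] (0 : ℝ), ∀ x A, ‖x' - x‖ = ε → closedBall x (2 * ε) ⊆ U ∧
      ((∀ z ∈ closedBall x (2 * ε), W z ≤ A) → κ * ε ≤ W x' - W x →
        W x' ≤ (A + W x) / 2 - (W x' - V x' + η) / 2 * ε ^ 2) := by
  have hWx := hpos x'
  set η := κ ^ 2 / (64 * W x') with hη
  have hηpos : 0 < η := by positivity
  refine ⟨η, hηpos, ?_⟩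
  set b := W x' - V x' + η with hb
  have hnear : ∀ᶠ x in 𝓝 x', x ∈ U ∧ W x < W x' + min (η / 4) (W x') ∧ W x' - η / 4 < W x ∧
      V x < V x' + η / 4 := by
    have h1 := (hW.continuousAt (hU.mem_nhds hx'))
    have h2 := (hV.continuousAt (hU.mem_nhds hx'))
    have h3 : 0 < min (η / 4) (W x') := lt_min (by positivity) hWx
    filter_upwards [hU.mem_nhds hx', h1.eventually (gt_mem_nhds (lt_add_of_pos_right _ h3)),
      h1.eventually (lt_mem_nhds (sub_lt_self _ (by positivity : 0 < η / 4))),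
      h2.eventually (gt_mem_nhds (lt_add_of_pos_right _ (by positivity : 0 < η / 4)))]
      with x a1 a2 a3 a4 using ⟨a1, a2, a3, a4⟩
  obtain ⟨R, hR, hnear⟩ := Metric.eventually_nhds_iff_ball.1 hnear
  have hε0 : ∀ᶠ ε in 𝓝[>] (0 : ℝ), ε < min (R / 4) (κ / (4 * (|b| + 1))) :=
    (gt_mem_nhds (lt_min (by positivity) (by positivity))).filter_mono nhdsWithin_le_nhds
  filter_upwards [hε0, self_mem_nhdsWithin] with ε hε hεpos x A hx
  replace hεpos : 0 < ε := hεpos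
  have hεR : ε < R / 4 := hε.trans_le (min_le_left _ _)
  have hbε : |b| * ε ≤ κ / 4 := by
    have := hε.trans_le (min_le_right _ _)
    rw [lt_div_iff₀ (by positivity)] at this
    nlinarith [abs_nonneg b]
  have hball : closedBall x (2 * ε) ⊆ ball x' R :=
    closedBall_subset_ball' (by rw [dist_eq_norm, norm_sub_rev, hx]; linarith)
  refine ⟨fun z hz => (hnear z (hball hz)).1, fun hA hinc => ?_⟩
  by_contra! hlt
  set a := (A - W x) / (2 * ε) - b * ε with ha
  have ha2 : a * (2 * ε) = A - W x - 2 * b * ε ^ 2 := by rw [ha]; field_simp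
  obtain ⟨z, hzx, hzR, -, hmax⟩ := exists_isLocalMax_sub_cone (W := W) (y := x) (x₀ := x')
    (R := 2 * ε) (a := a) (b := b) (B := W x)
    (hW.mono fun z hz => (hnear z (hball hz)).1) le_rfl
    (fun z hz => by
      have := hA z (by rw [mem_closedBall, dist_eq_norm, hz])
      nlinarith) (by linarith) (by rw [hx]; nlinarith)
  obtain ⟨hzU, hz1, hz2, hz3⟩ := hnear z (hball (by rw [mem_closedBall, dist_eq_norm]; exact hzR.le))
  have hz1' : W z < W x' + η / 4 := hz1.trans_le (by gcongr; exact min_le_left _ _)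
  have hz4 : W z < 2 * W x' := by linarith [min_le_right (η / 4) (W x')]
  have hAW : κ / 2 ≤ (A - W x) / (2 * ε) := by
    have := hA x' (by rw [mem_closedBall, dist_eq_norm, hx]; linarith)
    rw [le_div_iff₀ (by positivity)]; linarith
  have hslope : κ / 4 ≤ a + b * ‖z - x‖ := by
    have h1 : |b * (‖z - x‖ - ε)| ≤ |b| * ε := by
      rw [abs_mul]
      gcongr
      rw [abs_le]; constructor <;> linarith [norm_nonneg (z - x)]
    have h2 := neg_abs_le (b * (‖z - x‖ - ε))
    rw [ha]; linarith
  have h1 := H z hzU x hzx a b (by linarith [hκ] : (0 : ℝ) < a + b * ‖z - x‖).ne' hmax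
  have h2 : 2 * η ≤ (a + b * ‖z - x‖) ^ 2 / W z := by
    have h3 : (κ / 4) ^ 2 ≤ (a + b * ‖z - x‖) ^ 2 := by gcongr
    rw [le_div_iff₀ (hpos z)]
    have h5 : η * (64 * W x') = κ ^ 2 := by rw [hη]; field_simp
    nlinarith
  linarith

theorem ConeTest.doubling_false {n : ℕ} {U : Set (EuclideanSpace ℝ (Fin n))}
    {W V Z Y : EuclideanSpace ℝ (Fin n) → ℝ} (hU : IsOpen U)
    (HW : ConeTest U W V) (HZ : ConeTest U Z Y) (hWpos : ∀ x, 0 < W x) (hZpos : ∀ x, 0 < Z x)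
    (hW : ContinuousOn W U) (hV : ContinuousOn V U) (hZ : ContinuousOn Z U)
    (hY : ContinuousOn Y U) {x' y' : EuclideanSpace ℝ (Fin n)} (hx' : x' ∈ U) (hy' : y' ∈ U)
    (hne : x' ≠ y') {κ : ℝ} (hκ : 0 < κ)
    (hmax : ∀ x ∈ U, ∀ y ∈ U, ‖x - y‖ ≤ ‖x' - y'‖ →
      W x + Z y ≤ W x' + Z y' + κ * (‖x - y‖ - ‖x' - y'‖))
    (hVY : V x' + Y y' ≤ W x' + Z y') : False := by
  obtain ⟨η₁, hη₁, h₁⟩ := HW.eventually_le_midpoint hWpos hU hW hV hx' hκ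
  obtain ⟨η₂, hη₂, h₂⟩ := HZ.eventually_le_midpoint hZpos hU hZ hY hy' hκ
  have hρ : 0 < ‖x' - y'‖ := norm_pos_iff.2 (sub_ne_zero.2 hne)
  have h₃ : ∀ᶠ ε in 𝓝[>] (0 : ℝ), ε < ‖x' - y'‖ / 2 :=
    (gt_mem_nhds (half_pos hρ)).filter_mono nhdsWithin_le_nhds
  obtain ⟨ε, hε₁, hε₂, hερ, hε⟩ := (h₁.and (h₂.and (h₃.and self_mem_nhdsWithin))).exists
  replace hε : 0 < ε := hε
  set ρ := ‖x' - y'‖ with hρdef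
  have hnorm : ∀ t : ℝ, 0 ≤ t → ‖(t / ρ) • (x' - y')‖ = t := fun t ht => by
    rw [norm_smul, ← hρdef, Real.norm_of_nonneg (by positivity), div_mul_cancel₀ _ hρ.ne']
  have hsmul : x' - y' = (ρ / ρ) • (x' - y') := by rw [div_self hρ.ne', one_smul]
  set x := x' - (ε / ρ) • (x' - y') with hx
  set y := y' + (ε / ρ) • (x' - y') with hy
  have hx'x : ‖x' - x‖ = ε := by
    rw [hx, sub_sub_cancel, hnorm ε hε.le]
  have hy'y : ‖y' - y‖ = ε := by
    rw [hy, norm_sub_rev, add_sub_cancel_left, hnorm ε hε.le]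
  have hxy : ‖x - y‖ = ρ - 2 * ε := by
    rw [← hnorm (ρ - 2 * ε) (by linarith)]
    congr 1
    rw [hx, hy, sub_div, sub_smul, ← hsmul, mul_div_assoc, two_mul, add_smul]
    abel
  have hxy' : ‖x - y'‖ = ρ - ε := by
    rw [← hnorm (ρ - ε) (by linarith)]
    congr 1
    rw [hx, sub_div, sub_smul, ← hsmul]
    abel
  have hx'y : ‖x' - y‖ = ρ - ε := by
    rw [← hnorm (ρ - ε) (by linarith)]
    congr 1
    rw [hy, sub_div, sub_smul, ← hsmul]
    abel
  obtain ⟨hBx, -⟩ := hε₁ x 0 hx'x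
  obtain ⟨hBy, -⟩ := hε₂ y 0 hy'y
  have hxU : x ∈ U := hBx (mem_closedBall_self (by positivity))
  have hyU : y ∈ U := hBy (mem_closedBall_self (by positivity))
  have hle : ∀ p ∈ U, ∀ q ∈ U, ‖p - q‖ ≤ ρ → W p + Z q ≤ W x' + Z y' := fun p hp q hq hpq => by
    have := hmax p hp q hq hpq
    nlinarith
  have e₁ := (hε₁ x (W x' + Z y' - Z y) hx'x).2 (fun z hz => by
    have hzy : ‖z - y‖ ≤ ρ := by
      rw [mem_closedBall, dist_eq_norm] at hz
      linarith [norm_sub_le_norm_sub_add_norm_sub z x y]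
    linarith [hle z (hBx hz) y hyU hzy]) (by
    have := hmax x hxU y' hy' (by linarith)
    rw [hxy'] at this
    linarith)
  have e₂ := (hε₂ y (W x' + Z y' - W x) hy'y).2 (fun z hz => by
    have hzx : ‖x - z‖ ≤ ρ := by
      rw [mem_closedBall, dist_eq_norm, norm_sub_rev] at hz
      linarith [norm_sub_le_norm_sub_add_norm_sub x y z]
    linarith [hle x hxU z (hBy hz) hzx]) (by
    have := hmax x' hx' y hyU (by linarith)
    rw [hx'y] at this
    linarith)
  have : 0 < (W x' - V x' + η₁ + (Z y' - Y y' + η₂)) * ε ^ 2 := by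
    have : 0 < W x' - V x' + η₁ + (Z y' - Y y' + η₂) := by linarith
    positivity
  nlinarith

theorem exists_max_bool {X : Type*} [TopologicalSpace X] {S : Set X} (hS : IsCompact S)
    (hne : S.Nonempty) {f : Bool → X → ℝ} (hf : ∀ i, ContinuousOn (f i) S) :
    ∃ i, ∃ x ∈ S, ∀ j, ∀ y ∈ S, f j y ≤ f i x := by
  choose x hx hmax using fun i => hS.exists_isMaxOn hne (hf i)
  obtain ⟨i, hi⟩ := Finite.exists_max fun i => f i (x i)
  exact ⟨i, x i, hx i, fun j y hy => (hmax j hy).trans (hi j)⟩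

theorem exists_modulus_bool {X : Type*} [PseudoMetricSpace X] {S : Set X} (hS : IsCompact S)
    {f : Bool → X → ℝ} (hf : ∀ i, ContinuousOn (f i) S) {τ : ℝ} (hτ : 0 < τ) :
    ∃ r > 0, ∀ i, ∀ x ∈ S, ∀ y ∈ S, dist x y ≤ r → |f i x - f i y| < τ := by
  choose d hd h using fun i =>
    Metric.uniformContinuousOn_iff.1 (hS.uniformContinuousOn_of_continuous (hf i)) τ hτ
  obtain ⟨i, hi⟩ := Finite.exists_min d
  exact ⟨d i / 2, half_pos (hd i), fun j x hx y hy hxy =>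
    h j x hx y hy (by linarith [hi j, hd i])⟩

theorem mem_of_mem_closure_of_pos {X : Type*} [TopologicalSpace X] {U : Set X} (hU : IsOpen U)
    {f : X → ℝ} (hf : ∀ x ∈ frontier U, f x ≤ 0) {x : X} (hx : x ∈ closure U) (hpos : 0 < f x) :
    x ∈ U := by
  by_contra h
  exact (hf x (by rw [hU.frontier_eq]; exact ⟨hx, h⟩)).not_gt hpos

theorem not_forall_near_le_max {n : ℕ} (hn : 1 ≤ n) {U : Set (EuclideanSpace ℝ (Fin n))}
    (hUo : IsOpen U) (hUb : Bornology.IsBounded U) {u w : Bool → EuclideanSpace ℝ (Fin n) → ℝ}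
    (hu : ∀ i, ContinuousOn (u i) (closure U)) (hw : ∀ i, ContinuousOn (w i) (closure U))
    (Hu : ∀ i, WeakSubPair U (u i) (u !i)) (Hw : ∀ i, WeakSubPair U (w i) (w !i))
    (hb : ∀ i, ∀ x ∈ frontier U, u i x + w i x ≤ 0) {M r : ℝ} (hM : 0 < M) (hr : 0 < r)
    {i₀ : Bool} {x₀ : EuclideanSpace ℝ (Fin n)} (hx₀ : x₀ ∈ closure U)
    (hx₀M : u i₀ x₀ + w i₀ x₀ = M) :
    ¬ ∀ i, ∀ x ∈ closure U, ∀ y ∈ closure U, ‖x - y‖ ≤ r → u i x + w i y ≤ M := by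
  intro hle
  have hmem : ∀ i, ∀ x ∈ closure U, u i x + w i x = M → x ∈ U := fun i x hx h =>
    mem_of_mem_closure_of_pos hUo (hb i) hx (by rw [h]; exact hM)
  have hnear : ∀ x ∈ U, ∀ᶠ y in 𝓝 x, y ∈ closure U ∧ ‖x - y‖ ≤ r := fun x hx => by
    filter_upwards [hUo.mem_nhds hx, closedBall_mem_nhds x hr] with y h1 h2
    rw [mem_closedBall, dist_comm, dist_eq_norm] at h2
    exact ⟨subset_closure h1, h2⟩
  have hother : ∀ i, ∀ x ∈ closure U, u i x + w i x = M →
      u i x ≤ u (!i) x ∧ u (!i) x + w (!i) x = M := fun i x hx h => by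
    have hxU := hmem i x hx h
    have h1 := (Hu i).1 x hxU (by
      filter_upwards [hnear x hxU] with y hy
      have := hle i y hy.1 x hx (by rw [norm_sub_rev]; exact hy.2)
      linarith)
    have h2 := (Hw i).1 x hxU (by
      filter_upwards [hnear x hxU] with y hy
      have := hle i x hx y hy.1 hy.2
      linarith)
    have h3 := hle (!i) x hx x hx (by simpa using hr.le)
    exact ⟨h1, by linarith⟩
  let S : Set (EuclideanSpace ℝ (Fin n)) := {x | x ∈ closure U ∧ ∀ i, u i x + w i x = M}
  have hSne : S.Nonempty := ⟨x₀, hx₀, fun i => by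
    rcases eq_or_ne i i₀ with rfl | h
    · exact hx₀M
    · rw [Bool.eq_not_of_ne h]
      exact (hother i₀ x₀ hx₀ hx₀M).2⟩
  have hSc : IsClosed S := by
    have : S = ⋂ i, (closure U ∩ (fun x => u i x + w i x) ⁻¹' {M}) := by
      ext x
      simp only [S, mem_ofPred_eq, mem_iInter, mem_inter_iff, mem_preimage, mem_singleton_iff]
      exact ⟨fun h i => ⟨h.1, h.2 i⟩, fun h => ⟨(h true).1, fun i => (h i).2⟩⟩
    rw [this]
    exact isClosed_iInter fun i =>
      ((hu i).add (hw i)).preimage_isClosed_of_isClosed isClosed_closure isClosed_singleton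
  have hSo : IsOpen S := by
    rw [isOpen_iff_mem_nhds]
    rintro x ⟨hx, hxM⟩
    have hxU := hmem i₀ x hx (hxM i₀)
    have hu_eq : ∀ i, u (!i) x = u i x := fun i =>
      le_antisymm (by simpa using (hother (!i) x hx (hxM _)).1) (hother i x hx (hxM i)).1
    have hw_eq : ∀ i, w (!i) x = w i x := fun i => by
      linarith [hxM i, hxM (!i), hu_eq i]
    obtain ⟨d, hd, hdU⟩ := Metric.isOpen_iff.1 hUo x hxU
    set s := min d (min r 1) with hs
    have hspos : 0 < s := lt_min hd (lt_min hr one_pos)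
    have hsr : s ≤ r := (min_le_right _ _).trans (min_le_left _ _)
    have hs1 : s ≤ 1 := (min_le_right _ _).trans (min_le_right _ _)
    have hsU : ball x s ⊆ U := (ball_subset_ball (min_le_left _ _)).trans hdU
    have hclose : ∀ y ∈ ball x s, y ∈ closure U ∧ ‖x - y‖ ≤ r ∧ ‖y - x‖ ≤ r := fun y hy => by
      refine ⟨subset_closure (hsU hy), ?_⟩
      rw [mem_ball, dist_eq_norm] at hy
      rw [norm_sub_rev x y]
      exact ⟨by linarith, by linarith⟩
    have hconst : ∀ f : Bool → EuclideanSpace ℝ (Fin n) → ℝ,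
        (∀ i, ContinuousOn (f i) (closure U)) → (∀ i, WeakSubPair U (f i) (f !i)) →
        (∀ i, f (!i) x = f i x) → (∀ i, ∀ y ∈ ball x s, f i y ≤ f i x) →
        ∀ i, ∀ y ∈ ball x (s / 2), f i y = f i x := fun f hf Hf hfe hfm i y hy => by
      have := ((Hf i).coneTest_exp one_pos).eq_of_le (fun _ => Real.exp_pos _) hs1 hsU
        (((hf i).mono subset_closure).const_mul 1).rexp
        (fun z hz => Real.exp_le_exp.2 (by linarith [hfm i z hz]))
        (fun z hz => Real.exp_le_exp.2 (by linarith [hfm (!i) z hz, hfe i])) hy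
      simpa using this
    filter_upwards [ball_mem_nhds x (half_pos hspos)] with y hy
    have hys : y ∈ ball x s := ball_subset_ball (by linarith) hy
    refine ⟨(hclose y hys).1, fun i => ?_⟩
    rw [hconst u hu Hu hu_eq (fun i z hz => by
        have := hle i z (hclose z hz).1 x hx (hclose z hz).2.2
        linarith [hxM i]) i y hy,
      hconst w hw Hw hw_eq (fun i z hz => by
        have := hle i x hx z (hclose z hz).1 (hclose z hz).2.1
        linarith [hxM i]) i y hy, hxM i]
  have : Nonempty (Fin n) := ⟨⟨0, hn⟩⟩
  have huniv : S = univ := (IsClopen.eq_univ ⟨hSc, hSo⟩ hSne)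
  have hbdd : Bornology.IsBounded (univ : Set (EuclideanSpace ℝ (Fin n))) :=
    hUb.closure.subset (huniv ▸ fun x hx => hx.1)
  exact NoncompactSpace.noncompact_univ
    (Metric.isCompact_of_isClosed_isBounded isClosed_univ hbdd)

theorem abs_exp_mul_sub_one_sub_le {δ s C τ : ℝ} (hδ : 0 < δ) (hs : |s| ≤ C) (h1 : δ * C ≤ 1)
    (h2 : δ * C ^ 2 ≤ τ) : |Real.exp (δ * s) - 1 - δ * s| ≤ δ * τ := by
  have h3 : |δ * s| ≤ δ * C := by rw [abs_mul, abs_of_pos hδ]; gcongr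
  have h4 := Real.abs_exp_sub_one_sub_id_le (h3.trans h1)
  have h5 : s ^ 2 ≤ C ^ 2 := by
    rw [← sq_abs s]; gcongr
  have h6 : δ * (δ * s ^ 2) ≤ δ * τ := by
    gcongr
    exact (mul_le_mul_of_nonneg_left h5 hδ.le).trans h2
  nlinarith

theorem add_nonpos_of_weakSubPair {n : ℕ} (hn : 1 ≤ n) {U : Set (EuclideanSpace ℝ (Fin n))}
    (hUo : IsOpen U) (hUb : Bornology.IsBounded U) {u w : Bool → EuclideanSpace ℝ (Fin n) → ℝ}
    (hu : ∀ i, ContinuousOn (u i) (closure U)) (hw : ∀ i, ContinuousOn (w i) (closure U))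
    (Hu : ∀ i, WeakSubPair U (u i) (u !i)) (Hw : ∀ i, WeakSubPair U (w i) (w !i))
    (hb : ∀ i, ∀ x ∈ frontier U, u i x + w i x ≤ 0) (i : Bool) {x : EuclideanSpace ℝ (Fin n)}
    (hx : x ∈ closure U) : u i x + w i x ≤ 0 := by
  by_contra! hpos
  have hK : IsCompact (closure U) := hUb.isCompact_closure
  obtain ⟨i₀, x₀, hx₀, hmax₀⟩ := exists_max_bool hK ⟨x, hx⟩ fun i => (hu i).add (hw i)
  simp only [Pi.add_apply] at hmax₀
  obtain ⟨M, hMdef⟩ : ∃ M, M = u i₀ x₀ + w i₀ x₀ := ⟨_, rfl⟩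
  rw [← hMdef] at hmax₀
  have hM : 0 < M := hpos.trans_le (hmax₀ i x hx)
  obtain ⟨r₁, hr₁, hmod₁⟩ := exists_modulus_bool hK hu hM
  obtain ⟨r₂, hr₂, hmod₂⟩ := exists_modulus_bool hK hw hM
  set r := min r₁ r₂ with hrdef
  have hr : 0 < r := lt_min hr₁ hr₂
  have hmemU : ∀ i, ∀ x ∈ closure U, ∀ y ∈ closure U, ‖x - y‖ ≤ r → M < u i x + w i y →
      x ∈ U ∧ y ∈ U := fun i x hx y hy hxy h => by
    have h1 := (abs_lt.1 (hmod₁ i x hx y hy (by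
      rw [dist_eq_norm]; exact hxy.trans (min_le_left _ _)))).2
    have h2 := (abs_lt.1 (hmod₂ i x hx y hy (by
      rw [dist_eq_norm]; exact hxy.trans (min_le_right _ _)))).1
    exact ⟨mem_of_mem_closure_of_pos hUo (hb i) hx (by linarith),
      mem_of_mem_closure_of_pos hUo (hb i) hy (by linarith)⟩
  have hnot := not_forall_near_le_max hn hUo hUb hu hw Hu Hw hb hM hr hx₀ hMdef.symm
  push Not at hnot
  obtain ⟨i₁, x₁, hx₁, y₁, hy₁, hxy₁, hlt⟩ := hnot
  obtain ⟨C, hC0, hCu, hCw⟩ : ∃ C > 0, (∀ i, ∀ x ∈ closure U, |u i x| ≤ C) ∧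
      ∀ i, ∀ x ∈ closure U, |w i x| ≤ C := by
    choose c hc using fun i => hK.exists_bound_of_continuousOn (hu i)
    choose d hd using fun i => hK.exists_bound_of_continuousOn (hw i)
    obtain ⟨j, hj⟩ := Finite.exists_max c
    obtain ⟨k, hk⟩ := Finite.exists_max d
    refine ⟨max 1 (max (c j) (d k)), by positivity, fun i x hx => ?_, fun i x hx => ?_⟩
    · exact (hc i x hx).trans ((hj i).trans ((le_max_left _ _).trans (le_max_right _ _)))
    · exact (hd i x hx).trans ((hk i).trans ((le_max_right _ _).trans (le_max_right _ _)))
  obtain ⟨τ, hτdef⟩ : ∃ τ, τ = (u i₁ x₁ + w i₁ y₁ - M) / 2 := ⟨_, rfl⟩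
  have hτ : 0 < τ := by linarith
  obtain ⟨δ, hδ, hδ1, hδ2⟩ : ∃ δ > 0, δ * C ≤ 1 ∧ δ * C ^ 2 ≤ τ / 8 := by
    refine ⟨min (1 / C) (τ / 8 / C ^ 2), by positivity, ?_, ?_⟩
    · rw [← le_div_iff₀ hC0]; exact min_le_left _ _
    · rw [← le_div_iff₀ (by positivity)]; exact min_le_right _ _
  have hGu := fun i x hx => abs_le.1 (abs_exp_mul_sub_one_sub_le hδ (hCu i x hx) hδ1 hδ2)
  have hGw := fun i x hx => abs_le.1 (abs_exp_mul_sub_one_sub_le hδ (hCw i x hx) hδ1 hδ2)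
  set κ := δ * (τ / r) with hκ
  have hκpos : 0 < κ := by positivity
  set W := fun i x => Real.exp (δ * u i x) with hW
  set Z := fun i x => Real.exp (δ * w i x) with hZ
  have hWc : ∀ i, ContinuousOn (W i) (closure U) := fun i => ((hu i).const_mul δ).rexp
  have hZc : ∀ i, ContinuousOn (Z i) (closure U) := fun i => ((hw i).const_mul δ).rexp
  let D : Set (EuclideanSpace ℝ (Fin n) × EuclideanSpace ℝ (Fin n)) :=
    (closure U ×ˢ closure U) ∩ {p | ‖p.1 - p.2‖ ≤ r}
  have hD : IsCompact D :=
    (hK.prod hK).inter_right (isClosed_le (by fun_prop) continuous_const)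
  obtain ⟨j, ⟨x', y'⟩, ⟨⟨hx', hy'⟩, hxy'⟩, hmax⟩ := exists_max_bool hD
    ⟨(x₁, y₁), ⟨hx₁, hy₁⟩, hxy₁⟩
    (f := fun i p => W i p.1 + Z i p.2 - κ * ‖p.1 - p.2‖) (fun i => by
      refine (ContinuousOn.add ?_ ?_).sub (by fun_prop)
      · exact (hWc i).comp continuousOn_fst fun p hp => hp.1.1
      · exact (hZc i).comp continuousOn_snd fun p hp => hp.1.2)
  simp only [mem_ofPred_eq] at hx' hy' hxy' hmax
  have hbig : M + τ / 2 + τ / r * ‖x' - y'‖ ≤ u j x' + w j y' := by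
    have h0 := hmax i₁ (x₁, y₁) ⟨⟨hx₁, hy₁⟩, hxy₁⟩
    simp only [hW, hZ] at h0
    have h1 := (hGu i₁ x₁ hx₁).1
    have h2 := (hGw i₁ y₁ hy₁).1
    have h3 := (hGu j x' hx').2
    have h4 := (hGw j y' hy').2
    have h5 : κ * ‖x₁ - y₁‖ ≤ δ * τ := by
      calc κ * ‖x₁ - y₁‖ ≤ κ * r := by gcongr
        _ = δ * τ := by rw [hκ]; field_simp
    have h6 : δ * (M + τ / 2 + τ / r * ‖x' - y'‖) ≤ δ * (u j x' + w j y') := by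
      have : δ * (τ / r * ‖x' - y'‖) = κ * ‖x' - y'‖ := by rw [hκ]; ring
      have h7 : δ * τ = δ * (u i₁ x₁ + w i₁ y₁ - M) / 2 := by rw [hτdef]; ring
      linarith
    exact le_of_mul_le_mul_left h6 hδ
  have hnn : 0 ≤ τ / r * ‖x' - y'‖ := by positivity
  obtain ⟨hx'U, hy'U⟩ := hmemU j x' hx' y' hy' hxy' (by linarith)
  have hne : x' ≠ y' := by
    rintro rfl
    linarith [hmax₀ j x' hx']
  have hcone : ∀ i, ConeTest U (W i) (W !i) := fun i => (Hu i).coneTest_exp hδ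
  have hcone' : ∀ i, ConeTest U (Z i) (Z !i) := fun i => (Hw i).coneTest_exp hδ
  refine (hcone j).doubling_false hUo (hcone' j) (fun _ => Real.exp_pos _)
    (fun _ => Real.exp_pos _) ((hWc _).mono subset_closure) ((hWc _).mono subset_closure)
    ((hZc _).mono subset_closure) ((hZc _).mono subset_closure) hx'U hy'U hne hκpos
    (fun p hp q hq hpq => ?_) ?_
  · have := hmax j (p, q) ⟨⟨subset_closure hp, subset_closure hq⟩, hpq.trans hxy'⟩
    simp only at this
    linarith
  · have := hmax (!j) (x', y') ⟨⟨hx', hy'⟩, hxy'⟩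
    simp only at this
    linarith

/-- Comparison Principle (Theorem 3.4). -/
theorem comparison_principle {n : ℕ} (hn : 1 ≤ n)
    {U : Set (EuclideanSpace ℝ (Fin n))} (hUo : IsOpen U) (hUb : Bornology.IsBounded U)
    {u₁ u₂ v₁ v₂ : EuclideanSpace ℝ (Fin n) → ℝ}
    (hu₁ : ContinuousOn u₁ (closure U)) (hu₂ : ContinuousOn u₂ (closure U))
    (hv₁ : ContinuousOn v₁ (closure U)) (hv₂ : ContinuousOn v₂ (closure U))
    (hsub : IsSubsolution U u₁ u₂) (hsup : IsSupersolution U v₁ v₂)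
    (hb₁ : ∀ x ∈ frontier U, u₁ x ≤ v₁ x) (hb₂ : ∀ x ∈ frontier U, u₂ x ≤ v₂ x) :
    (∀ x ∈ closure U, u₁ x ≤ v₁ x) ∧ (∀ x ∈ closure U, u₂ x ≤ v₂ x) := by
  have key := add_nonpos_of_weakSubPair hn hUo hUb (u := fun i => cond i u₁ u₂)
    (w := fun i x => -cond i v₁ v₂ x) (by rintro (_ | _) <;> assumption)
    (by rintro (_ | _); exacts [hv₂.neg, hv₁.neg])
    (by rintro (_ | _); exacts [hsub.2.2.2.weakSubPair, hsub.2.2.1.weakSubPair])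
    (by rintro (_ | _); exacts [hsup.2.2.2.weakSubPair_neg, hsup.2.2.1.weakSubPair_neg])
    (by
      rintro (_ | _) x hx
      · simpa using hb₂ x hx
      · simpa using hb₁ x hx)
  exact ⟨fun x hx => by simpa using key true hx, fun x hx => by simpa using key false hx⟩
end

section
/- Strong Maximum Principle (Theorem 3.3). Let U ⊆ ℝⁿ (n ≥ 1) be a connected, open, bounded set and let (u₁, u₂) be a viscosity supersolution of the system −Δ∞u₁ + u₁ − u₂ = 0, −Δ∞u₂ + u₂ − u₁ = 0 in U. Assume there exist x* ∈ U and i* ∈ {1,2} such that u_{i*}(x*) ≤ u_i(x) for all i ∈ {1,2} and all x ∈ U (i.e., min_{i=1,2} min_U u_i is attained at an interior point). Then there is a constant c ∈ ℝ with u₁(x) = u₂(x) = c for all x ∈ U. -/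
open Filter Metric Set Topology

/-- The gradient of the radial quartic barrier `x ↦ ε * (‖x - y‖² - M)²`. -/
theorem hasGradientAt_quarticBarrier {n : ℕ} (y : EuclideanSpace ℝ (Fin n)) (M ε : ℝ)
    (x : EuclideanSpace ℝ (Fin n)) :
    HasGradientAt (fun x => ε * (‖x - y‖ ^ 2 - M) ^ 2)
      ((4 * ε * (‖x - y‖ ^ 2 - M)) • (x - y)) x := by
  have h1 := ((((hasFDerivAt_id (𝕜 := ℝ) x).sub_const y).norm_sq.sub_const M).pow 2).const_mul ε
  rw [hasGradientAt_iff_hasFDerivAt]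
  refine h1.congr_fderiv ?_
  ext v
  simp
  ring

/-- The second derivative of the radial quartic barrier. -/
theorem secondDeriv_quarticBarrier {n : ℕ} (y : EuclideanSpace ℝ (Fin n)) (M ε : ℝ)
    (x v : EuclideanSpace ℝ (Fin n)) :
    secondDeriv (fun x => ε * (‖x - y‖ ^ 2 - M) ^ 2) x v =
      8 * ε * inner ℝ (x - y) v ^ 2 + 4 * ε * (‖x - y‖ ^ 2 - M) * ‖v‖ ^ 2 := by
  have h : fderiv ℝ (fun x => ε * (‖x - y‖ ^ 2 - M) ^ 2) =
      fun x => (4 * ε * (‖x - y‖ ^ 2 - M)) • innerSL ℝ (x - y) := by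
    funext x
    rw [(hasGradientAt_quarticBarrier y M ε x).hasFDerivAt.fderiv]
    ext w
    simp
  have h1 := (((hasFDerivAt_id (𝕜 := ℝ) x).sub_const y).norm_sq.sub_const M).const_mul (4 * ε)
  have h2 := (innerSL ℝ (E := EuclideanSpace ℝ (Fin n))).hasFDerivAt.comp x
    ((hasFDerivAt_id (𝕜 := ℝ) x).sub_const y)
  have h3 : HasFDerivAt (fun x => (4 * ε * (‖x - y‖ ^ 2 - M)) • innerSL ℝ (x - y)) _ x :=
    h1.smul h2
  rw [secondDeriv, iteratedFDeriv_two_apply, h, h3.fderiv]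
  have hv : innerSL ℝ v v = ‖v‖ ^ 2 := real_inner_self_eq_norm_sq v
  simp [hv, inner_sub_left]
  ring

theorem laplInfMinus_quarticBarrier {n : ℕ} {y x : EuclideanSpace ℝ (Fin n)} {M ε : ℝ}
    (hε : ε ≠ 0) (hxy : x ≠ y) (hM : ‖x - y‖ ^ 2 ≠ M) :
    laplInfMinus (fun x => ε * (‖x - y‖ ^ 2 - M) ^ 2) x = ε * (12 * ‖x - y‖ ^ 2 - 4 * M) := by
  have hx : ‖x - y‖ ≠ 0 := norm_ne_zero_iff.2 (sub_ne_zero.2 hxy)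
  have hM' : ‖x - y‖ ^ 2 - M ≠ 0 := sub_ne_zero.2 hM
  have hg : (4 * ε * (‖x - y‖ ^ 2 - M)) • (x - y) ≠ 0 :=
    smul_ne_zero (by positivity) (sub_ne_zero.2 hxy)
  rw [laplInfMinus, (hasGradientAt_quarticBarrier y M ε x).gradient, if_neg hg,
    secondDeriv_quarticBarrier, inner_smul_right, real_inner_self_eq_norm_sq, norm_smul,
    Real.norm_eq_abs]
  simp only [mul_pow, sq_abs]
  field_simp
  ring

theorem contDiff_quarticBarrier {n : ℕ} (y : EuclideanSpace ℝ (Fin n)) (M ε : ℝ) :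
    ContDiff ℝ 2 (fun x => ε * (‖x - y‖ ^ 2 - M) ^ 2) := by
  have : ContDiff ℝ 2 (fun x => ‖x - y‖ ^ 2) := (contDiff_id.sub contDiff_const).norm_sq ℝ
  fun_prop

theorem laplInfMinus_const {n : ℕ} (hn : 1 ≤ n) (c : ℝ) (x : EuclideanSpace ℝ (Fin n)) :
    laplInfMinus (fun _ => c) x = 0 := by
  have hset : {t : ℝ | ∃ v : EuclideanSpace ℝ (Fin n), ‖v‖ = 1 ∧
      t = secondDeriv (fun _ => c) x v} = {0} := by
    ext t
    simp only [secondDeriv, iteratedFDeriv_two_apply, mem_ofPred_eq, mem_singleton_iff]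
    refine ⟨fun ⟨v, _, h⟩ => by simpa using h, fun h => ?_⟩
    exact ⟨EuclideanSpace.single ⟨0, hn⟩ 1, by simp, by simpa using h⟩
  rw [laplInfMinus, hset]
  simp [gradient_fun_const]

/-- Where one component attains the minimum of both, the other component attains it too. -/
theorem SuperPair.le_of_forall_le {n : ℕ} (hn : 1 ≤ n) {U : Set (EuclideanSpace ℝ (Fin n))}
    {u v : EuclideanSpace ℝ (Fin n) → ℝ} (h : SuperPair U u v)
    {x : EuclideanSpace ℝ (Fin n)} (hx : x ∈ U) (hmin : ∀ z ∈ U, u x ≤ u z) : v x ≤ u x := by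
  have := h (fun _ => 0) contDiff_const x hx <| by
    filter_upwards [self_mem_nhdsWithin] with z hz using by simpa using hmin z hz
  rw [laplInfMinus_const hn] at this
  linarith

/-- The minimum of the two components, minus a smooth function `φ`, has a local minimum
only where `laplInfMinus φ ≤ 0`. -/
theorem IsSupersolution.laplInfMinus_nonpos {n : ℕ} {U : Set (EuclideanSpace ℝ (Fin n))}
    {u₁ u₂ : EuclideanSpace ℝ (Fin n) → ℝ} (h : IsSupersolution U u₁ u₂)
    {φ : EuclideanSpace ℝ (Fin n) → ℝ} (hφ : ContDiff ℝ 2 φ)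
    {x : EuclideanSpace ℝ (Fin n)} (hx : x ∈ U)
    (hmin : IsLocalMinOn (fun z => min (u₁ z) (u₂ z) - φ z) U x) : laplInfMinus φ x ≤ 0 := by
  rcases le_total (u₁ x) (u₂ x) with hle | hle
  · have := h.2.2.1 φ hφ x hx <| by
      filter_upwards [hmin] with z hz
      rw [min_eq_left hle] at hz
      linarith [min_le_left (u₁ z) (u₂ z)]
    linarith
  · have := h.2.2.2 φ hφ x hx <| by
      filter_upwards [hmin] with z hz
      rw [min_eq_right hle] at hz
      linarith [min_le_right (u₁ z) (u₂ z)]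
    linarith

/-- Hopf-type lemma: the minimum set of `min u₁ u₂` cannot be touched from outside by a ball. -/
theorem IsSupersolution.not_touching_ball {n : ℕ} {U : Set (EuclideanSpace ℝ (Fin n))}
    {u₁ u₂ : EuclideanSpace ℝ (Fin n) → ℝ} (h : IsSupersolution U u₁ u₂)
    {c R : ℝ} (hR : 0 < R) {y z : EuclideanSpace ℝ (Fin n)}
    (hsub : closedBall y (1.4 * R) ⊆ U) (hc : ∀ x ∈ U, c ≤ min (u₁ x) (u₂ x))
    (hball : ∀ x ∈ ball y R, c < min (u₁ x) (u₂ x)) (hz : dist z y = R) :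
    c < min (u₁ z) (u₂ z) := by
  by_contra! hzc
  set m : EuclideanSpace ℝ (Fin n) → ℝ := fun x => min (u₁ x) (u₂ x)
  have hlsc : LowerSemicontinuousOn m U := h.1.inf h.2.1
  have hin : closedBall y (0.9 * R) ⊆ ball y R := closedBall_subset_ball (by linarith)
  have hinU : closedBall y (0.9 * R) ⊆ U :=
    (closedBall_subset_closedBall (by linarith)).trans hsub
  obtain ⟨a, ha, hamin⟩ := (hlsc.mono hinU).exists_isMinOn
    ⟨y, mem_closedBall_self (by positivity)⟩ (isCompact_closedBall _ _)
  have hca : c < m a := hball a (hin ha)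
  set ε : ℝ := (m a - c) / R ^ 4 with hεdef
  have hε : 0 < ε := div_pos (by linarith) (by positivity)
  have hεR : ε * R ^ 4 = m a - c := by rw [hεdef]; field_simp
  set φ : EuclideanSpace ℝ (Fin n) → ℝ := fun x => ε * (‖x - y‖ ^ 2 - 2 * R ^ 2) ^ 2 with hφdef
  have hφ : ContDiff ℝ 2 φ := contDiff_quarticBarrier y _ ε
  have hAcomp : IsCompact (closedBall y (1.4 * R) \ ball y (0.9 * R)) :=
    (isCompact_closedBall _ _).diff isOpen_ball
  have hlsc' : LowerSemicontinuousOn (fun x => m x - φ x)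
      (closedBall y (1.4 * R) \ ball y (0.9 * R)) := by
    simp only [sub_eq_add_neg]
    exact (hlsc.mono (sdiff_subset.trans hsub)).add
      (hφ.continuous.neg.lowerSemicontinuous.lowerSemicontinuousOn _)
  have hzA : z ∈ closedBall y (1.4 * R) \ ball y (0.9 * R) := by
    simp only [Set.mem_sdiff, mem_closedBall, mem_ball, hz]
    constructor <;> linarith
  obtain ⟨x, hxA, hxmin⟩ := hlsc'.exists_isMinOn ⟨z, hzA⟩ hAcomp
  have hxU : x ∈ U := hsub hxA.1
  have hxz : m x - φ x ≤ c - (m a - c) := by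
    have h1 : m x - φ x ≤ m z - φ z := hxmin hzA
    have h2 : φ z = m a - c := by
      simp only [hφdef, ← dist_eq_norm, hz, ← hεR]; ring
    have h3 : m z ≤ c := hzc
    linarith
  have hx1 : dist x y ≤ 1.4 * R := hxA.1
  have hx2 : 0.9 * R ≤ dist x y := not_lt.1 hxA.2
  have hx1' : dist x y ≠ 1.4 * R := by
    intro he
    have h2 : φ x = 0.0016 * (m a - c) := by
      simp only [hφdef, ← dist_eq_norm, he, ← hεR]; ring
    have h3 : c ≤ m x := hc x hxU
    linarith
  have hx2' : dist x y ≠ 0.9 * R := by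
    intro he
    have h2 : φ x = 1.4161 * (m a - c) := by
      simp only [hφdef, ← dist_eq_norm, he, ← hεR]; ring
    have h3 : m a ≤ m x := hamin (mem_closedBall.2 he.le)
    linarith
  have hx1s := lt_of_le_of_ne hx1 hx1'
  have hx2s := lt_of_le_of_ne hx2 hx2'.symm
  have hloc : IsLocalMinOn (fun x => m x - φ x) U x := by
    have hnhds : closedBall y (1.4 * R) \ ball y (0.9 * R) ∈ 𝓝 x := by
      have ho : IsOpen (ball y (1.4 * R) \ closedBall y (0.9 * R)) :=
        isOpen_ball.sdiff isClosed_closedBall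
      refine mem_of_superset (ho.mem_nhds ⟨hx1s, not_le.2 hx2s⟩) ?_
      exact sdiff_subset_sdiff ball_subset_closedBall ball_subset_closedBall
    exact (hxmin.isLocalMin hnhds).on U
  have hlap := h.laplInfMinus_nonpos hφ hxU hloc
  have hne : x ≠ y := by
    rintro rfl
    rw [dist_self] at hx2s
    linarith
  rw [dist_eq_norm] at hx1s hx2s
  have hupper : ‖x - y‖ ^ 2 < 2 * R ^ 2 := by nlinarith [norm_nonneg (x - y)]
  have hlower : 2 * R ^ 2 < 3 * ‖x - y‖ ^ 2 := by nlinarith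
  rw [hφdef, laplInfMinus_quarticBarrier hε.ne' hne hupper.ne] at hlap
  nlinarith

/-- The set where `min u₁ u₂` attains its minimum is open. -/
theorem IsSupersolution.isOpen_minimum_set {n : ℕ} {U : Set (EuclideanSpace ℝ (Fin n))}
    (hUo : IsOpen U) {u₁ u₂ : EuclideanSpace ℝ (Fin n) → ℝ} (h : IsSupersolution U u₁ u₂)
    {c : ℝ} (hc : ∀ x ∈ U, c ≤ min (u₁ x) (u₂ x)) :
    IsOpen {x | x ∈ U ∧ min (u₁ x) (u₂ x) ≤ c} := by
  rw [Metric.isOpen_iff]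
  rintro z₀ ⟨hz₀U, hz₀⟩
  obtain ⟨ρ, hρ, hρU⟩ := Metric.isOpen_iff.1 hUo z₀ hz₀U
  have hsub : closedBall z₀ (3 * (ρ / 4)) ⊆ U :=
    (closedBall_subset_ball (by linarith)).trans hρU
  refine ⟨ρ / 4, by positivity, fun y hy => ?_⟩
  have hy' : dist y z₀ < ρ / 4 := hy
  have hyU : y ∈ U := hsub (mem_closedBall.2 (by linarith))
  by_contra hyK
  have hlsc : LowerSemicontinuousOn (fun x => min (u₁ x) (u₂ x)) U := h.1.inf h.2.1
  have hC := (hlsc.mono hsub).isCompact_inter_preimage_Iic (isCompact_closedBall _ _) c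
  obtain ⟨z, hz, hyz⟩ := hC.exists_infDist_eq_dist
    ⟨z₀, mem_closedBall_self (by positivity), hz₀⟩ y
  have hle : ∀ w ∈ closedBall z₀ (3 * (ρ / 4)) ∩ (fun x => min (u₁ x) (u₂ x)) ⁻¹' Iic c,
      dist y z ≤ dist y w := fun w hw => hyz ▸ infDist_le_dist_of_mem hw
  have hRlt : dist y z < ρ / 4 :=
    (hle z₀ ⟨mem_closedBall_self (by positivity), hz₀⟩).trans_lt hy'
  have hRpos : 0 < dist y z := by
    refine dist_pos.2 ?_
    rintro rfl
    exact hyK ⟨hyU, hz.2⟩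
  have hin : closedBall y (1.4 * dist y z) ⊆ closedBall z₀ (3 * (ρ / 4)) :=
    closedBall_subset_closedBall' (by linarith)
  refine absurd hz.2 (not_le.2 (h.not_touching_ball hRpos (hin.trans hsub) hc ?_ (dist_comm z y)))
  intro w hw
  by_contra! hwc
  have hwd : dist w y < dist y z := hw
  have := hle w ⟨hin (mem_closedBall.2 (by linarith)), hwc⟩
  rw [dist_comm y w] at this
  linarith

/-- Strong Maximum Principle (Theorem 3.3). -/
theorem strong_maximum_principle {n : ℕ} (hn : 1 ≤ n)
    {U : Set (EuclideanSpace ℝ (Fin n))} (hUc : IsConnected U) (hUo : IsOpen U)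
    (hUb : Bornology.IsBounded U)
    {u₁ u₂ : EuclideanSpace ℝ (Fin n) → ℝ}
    (hsup : IsSupersolution U u₁ u₂)
    (hmin : ∃ xs ∈ U, (∀ x ∈ U, u₁ xs ≤ u₁ x ∧ u₁ xs ≤ u₂ x) ∨
      (∀ x ∈ U, u₂ xs ≤ u₁ x ∧ u₂ xs ≤ u₂ x)) :
    ∃ c : ℝ, ∀ x ∈ U, u₁ x = c ∧ u₂ x = c := by
  obtain ⟨c, ⟨xs, hxs, hxsc⟩, hc⟩ : ∃ c : ℝ, (∃ x ∈ U, min (u₁ x) (u₂ x) ≤ c) ∧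
      ∀ x ∈ U, c ≤ min (u₁ x) (u₂ x) := by
    obtain ⟨xs, hxs, h | h⟩ := hmin
    · exact ⟨u₁ xs, ⟨xs, hxs, min_le_left _ _⟩, fun x hx => le_min (h x hx).1 (h x hx).2⟩
    · exact ⟨u₂ xs, ⟨xs, hxs, min_le_right _ _⟩, fun x hx => le_min (h x hx).1 (h x hx).2⟩
  have hlsc : LowerSemicontinuousOn (fun x => min (u₁ x) (u₂ x)) U := hsup.1.inf hsup.2.1
  obtain ⟨V, hV, hUV⟩ := lowerSemicontinuousOn_iff_preimage_Ioi.1 hlsc c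
  have hopen : IsOpen (U ∩ (fun x => min (u₁ x) (u₂ x)) ⁻¹' Ioi c) := hUV ▸ hUo.inter hV
  have hsubset : U ⊆ {x | x ∈ U ∧ min (u₁ x) (u₂ x) ≤ c} := by
    refine hUc.isPreconnected.subset_left_of_subset_union (hsup.isOpen_minimum_set hUo hc) hopen
      ?_ ?_ ⟨xs, hxs, hxs, hxsc⟩
    · exact disjoint_left.2 fun x hx hx' => absurd hx.2 (not_le.2 hx'.2)
    · exact fun x hx => (le_or_gt (min (u₁ x) (u₂ x)) c).imp (⟨hx, ·⟩) (⟨hx, ·⟩)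
  refine ⟨c, fun x hx => ?_⟩
  have hx₁ : c ≤ u₁ x := (hc x hx).trans (min_le_left _ _)
  have hx₂ : c ≤ u₂ x := (hc x hx).trans (min_le_right _ _)
  rcases min_le_iff.1 (hsubset hx).2 with hle | hle
  · have := hsup.2.2.1.le_of_forall_le hn hx fun z hz =>
      hle.trans ((hc z hz).trans (min_le_left _ _))
    exact ⟨le_antisymm hle hx₁, le_antisymm (this.trans hle) hx₂⟩
  · have := hsup.2.2.2.le_of_forall_le hn hx fun z hz =>
      hle.trans ((hc z hz).trans (min_le_right _ _))
    exact ⟨le_antisymm (this.trans hle) hx₁, le_antisymm hle hx₂⟩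
end

section
/- Characterization of subsolutions (Theorem 4.1, subsolution part). Let U ⊆ ℝⁿ (n ≥ 1) be a bounded open set and let (u₁, u₂) be a pair of continuous real functions on the closure of U. Then (u₁, u₂) is a viscosity subsolution of the system −Δ∞u₁ + u₁ − u₂ = 0, −Δ∞u₂ + u₂ − u₁ = 0 in U if and only if (u₁, u₂) enjoys comparison with generalized cones from above in U. -/
open Filter Metric Set Topology

/-- `(u₁, u₂)` enjoys comparison with generalized cones from above in `U`. -/
def ComparisonAbove {n : ℕ} (U : Set (EuclideanSpace ℝ (Fin n))) (u₁ u₂ : EuclideanSpace ℝ (Fin n) → ℝ) : Prop :=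
  ∀ x₀ ∈ U, ∀ r : ℝ, 0 < r → closedBall x₀ r ⊆ U →
    ∀ C₁ C₂ a b : ℝ,
      (∀ x ∈ sphere x₀ r ∪ {x₀},
        u₁ x ≤ cone₁ x₀ C₁ C₂ a b x ∧ u₂ x ≤ cone₂ x₀ C₁ C₂ a b x) →
      ∀ x ∈ closedBall x₀ r,
        u₁ x ≤ cone₁ x₀ C₁ C₂ a b x ∧ u₂ x ≤ cone₂ x₀ C₁ C₂ a b x

theorem secondDeriv_eq_fderiv {n : ℕ} (φ : EuclideanSpace ℝ (Fin n) → ℝ)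
    (x v : EuclideanSpace ℝ (Fin n)) :
    secondDeriv φ x v = fderiv ℝ (fderiv ℝ φ) x v v := by
  simp [secondDeriv, iteratedFDeriv_two_apply]

/-- The germ of a function which is `C²` at a point extends to a global `C²` function. -/
theorem ContDiffAt.exists_contDiff_eventuallyEq {n : ℕ} {f : EuclideanSpace ℝ (Fin n) → ℝ}
    {x : EuclideanSpace ℝ (Fin n)} (hf : ContDiffAt ℝ 2 f x) :
    ∃ g : EuclideanSpace ℝ (Fin n) → ℝ, ContDiff ℝ 2 g ∧ g =ᶠ[𝓝 x] f := by
  obtain ⟨ε, hε, hball⟩ := Metric.eventually_nhds_iff_ball.1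
    (hf.eventually (by simp))
  let χ : ContDiffBump x := ⟨ε / 4, ε / 2, by positivity, by linarith⟩
  refine ⟨fun y => χ y * f y, contDiff_iff_contDiffAt.2 fun y => ?_, ?_⟩
  · by_cases hy : y ∈ ball x ε
    · exact χ.contDiffAt.mul (hball y hy)
    · have hy' : y ∉ tsupport χ := by
        rw [χ.tsupport_eq]
        intro h
        exact hy ((mem_closedBall.1 h).trans_lt (half_lt_self hε))
      refine (contDiffAt_const (c := (0 : ℝ))).congr_of_eventuallyEq ?_
      filter_upwards [notMem_tsupport_iff_eventuallyEq.1 hy'] with z hz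
      simp [hz]
  · filter_upwards [χ.eventuallyEq_one] with z hz
    simp [hz]

theorem laplInfPlus_congr {n : ℕ} {φ ψ : EuclideanSpace ℝ (Fin n) → ℝ}
    {x : EuclideanSpace ℝ (Fin n)} (h : φ =ᶠ[𝓝 x] ψ) : laplInfPlus φ x = laplInfPlus ψ x := by
  have h1 : gradient φ x = gradient ψ x := by
    simp only [gradient, h.fderiv_eq]
  have h2 : ∀ v, secondDeriv φ x v = secondDeriv ψ x v := fun v => by
    rw [secondDeriv_eq_fderiv, secondDeriv_eq_fderiv, h.fderiv.fderiv_eq]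
  simp only [laplInfPlus, h1, h2]

/-- In the definition of subsolution it is enough for test functions to be `C²` at the
touching point. -/
theorem SubPair.le_of_contDiffAt {n : ℕ} {U : Set (EuclideanSpace ℝ (Fin n))}
    {u v : EuclideanSpace ℝ (Fin n) → ℝ} (hu : SubPair U u v)
    {φ : EuclideanSpace ℝ (Fin n) → ℝ} {x : EuclideanSpace ℝ (Fin n)} (hx : x ∈ U)
    (hφ : ContDiffAt ℝ 2 φ x) (hmax : IsLocalMax (fun y => u y - φ y) x) :
    u x - v x ≤ laplInfPlus φ x := by
  obtain ⟨g, hg, hgφ⟩ := hφ.exists_contDiff_eventuallyEq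
  have hmax' : IsLocalMax (fun y => u y - g y) x := by
    have h : (fun y => u y - φ y) =ᶠ[𝓝 x] fun y => u y - g y := by
      filter_upwards [hgφ] with y hy
      rw [hy]
    exact hmax.congr h
  have := hu g hg x hx (hmax'.on U)
  rw [laplInfPlus_congr hgφ] at this
  linarith

theorem hasFDerivAt_half_mul_norm_sub_sq {n : ℕ} (κ c : ℝ) (x y : EuclideanSpace ℝ (Fin n)) :
    HasFDerivAt (fun z => c + κ / 2 * ‖z - x‖ ^ 2) (κ • innerSL ℝ (y - x)) y := by
  have h := ((((hasFDerivAt_id y).sub_const x).norm_sq).const_mul (κ / 2)).const_add c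
  refine h.congr_fderiv ?_
  ext v
  simp
  ring

/-- The operator `Δ∞⁺` on a quadratic function centred at the point. -/
theorem laplInfPlus_half_mul_norm_sub_sq {n : ℕ} (hn : 1 ≤ n) (κ c : ℝ)
    (x : EuclideanSpace ℝ (Fin n)) :
    laplInfPlus (fun z => c + κ / 2 * ‖z - x‖ ^ 2) x = κ := by
  have hf : fderiv ℝ (fun z => c + κ / 2 * ‖z - x‖ ^ 2) =
      fun y => κ • innerSL ℝ (y - x) :=
    funext fun y => (hasFDerivAt_half_mul_norm_sub_sq κ c x y).fderiv
  have hg : gradient (fun z => c + κ / 2 * ‖z - x‖ ^ 2) x = 0 := by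
    rw [gradient, hf]
    simp
  have hs : ∀ v : EuclideanSpace ℝ (Fin n),
      secondDeriv (fun z => c + κ / 2 * ‖z - x‖ ^ 2) x v = κ * ‖v‖ ^ 2 := fun v => by
    have h2 : HasFDerivAt (fun y : EuclideanSpace ℝ (Fin n) => κ • innerSL ℝ (y - x))
        (κ • innerSL ℝ) x :=
      (((innerSL ℝ).hasFDerivAt.comp x ((hasFDerivAt_id x).sub_const x))).const_smul κ
    rw [secondDeriv_eq_fderiv, hf, h2.fderiv]
    exact congrArg (κ * ·) (real_inner_self_eq_norm_sq v)
  have : Nonempty (Fin n) := ⟨⟨0, hn⟩⟩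
  obtain ⟨e, he⟩ := exists_norm_eq (EuclideanSpace ℝ (Fin n)) zero_le_one
  have hset : {t : ℝ | ∃ v : EuclideanSpace ℝ (Fin n), ‖v‖ = 1 ∧
      t = secondDeriv (fun z => c + κ / 2 * ‖z - x‖ ^ 2) x v} = {κ} := by
    ext t
    simp only [mem_ofPred_eq, mem_singleton_iff, hs]
    constructor
    · rintro ⟨v, hv, rfl⟩
      simp [hv]
    · rintro rfl
      exact ⟨e, he, by simp [he]⟩
  rw [laplInfPlus, if_pos hg, hset, csSup_singleton]

theorem hasFDerivAt_comp_norm_sub {n : ℕ} {F : ℝ → ℝ} {F' : ℝ} {c y : EuclideanSpace ℝ (Fin n)}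
    (hF : HasDerivAt F F' ‖y - c‖) (hy : y ≠ c) :
    HasFDerivAt (fun z => F ‖z - c‖) ((F' / ‖y - c‖) • innerSL ℝ (y - c)) y := by
  have hr : ‖y - c‖ ≠ 0 := norm_ne_zero_iff.2 (sub_ne_zero.2 hy)
  have h1 : HasFDerivAt (fun z : EuclideanSpace ℝ (Fin n) => ‖z - c‖)
      (‖y - c‖⁻¹ • innerSL ℝ (y - c)) y := by
    have h := (((hasFDerivAt_id y).sub_const c).norm_sq).sqrt (by simpa [sub_eq_zero] using hy)
    simp only [id, Real.sqrt_sq (norm_nonneg _)] at h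
    refine h.congr_fderiv ?_
    ext v
    simp
    field_simp
  refine (hF.comp_hasFDerivAt y h1).congr_fderiv ?_
  ext v
  simp
  field_simp

/-- The infinity Laplacian of a radial function at a noncritical point. -/
theorem laplInfPlus_comp_norm_sub {n : ℕ} {F F' F'' : ℝ → ℝ}
    (hF : ∀ t, HasDerivAt F (F' t) t) (hF' : ∀ t, HasDerivAt F' (F'' t) t)
    (hF'' : Continuous F'') {c x : EuclideanSpace ℝ (Fin n)} (hx : x ≠ c)
    (hne : F' ‖x - c‖ ≠ 0) :
    ContDiffAt ℝ 2 (fun z => F ‖z - c‖) x ∧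
      laplInfPlus (fun z => F ‖z - c‖) x = F'' ‖x - c‖ := by
  have hr : 0 < ‖x - c‖ := norm_pos_iff.2 (sub_ne_zero.2 hx)
  have hC : ContDiff ℝ 2 F := by
    have e : deriv F = F' := funext fun t => (hF t).deriv
    have e' : deriv F' = F'' := funext fun t => (hF' t).deriv
    rw [show (2 : WithTop ℕ∞) = 1 + 1 by norm_num, contDiff_succ_iff_deriv]
    refine ⟨fun t => (hF t).differentiableAt, by simp, ?_⟩
    rw [e, contDiff_one_iff_deriv, e']
    exact ⟨fun t => (hF' t).differentiableAt, hF''⟩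
  have hCD : ContDiffAt ℝ 2 (fun z => F ‖z - c‖) x :=
    hC.contDiffAt.comp x ((contDiffAt_id.sub contDiffAt_const).norm ℝ (sub_ne_zero.2 hx))
  refine ⟨hCD, ?_⟩
  set φ : EuclideanSpace ℝ (Fin n) → ℝ := fun z => F ‖z - c‖ with hφ
  have hfd : ∀ y, y ≠ c → HasFDerivAt φ ((F' ‖y - c‖ / ‖y - c‖) • innerSL ℝ (y - c)) y :=
    fun y hy => hasFDerivAt_comp_norm_sub (hF _) hy
  have hgrad : gradient φ x = (F' ‖x - c‖ / ‖x - c‖) • (x - c) := by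
    apply HasGradientAt.gradient
    rw [hasGradientAt_iff_hasFDerivAt]
    refine (hfd x hx).congr_fderiv ?_
    ext v
    simp
  have hB : fderiv ℝ (fderiv ℝ φ) x (x - c) (x - c) = F'' ‖x - c‖ * ‖x - c‖ ^ 2 := by
    have hd : HasFDerivAt (fderiv ℝ φ) (fderiv ℝ (fderiv ℝ φ) x) x :=
      ((hCD.fderiv_right (m := 1) (by norm_num)).differentiableAt (by simp)).hasFDerivAt
    have hline : HasDerivAt (fun t : ℝ => x + t • (x - c)) (x - c) 0 := by
      simpa using ((hasDerivAt_id (0 : ℝ)).smul_const (x - c)).const_add x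
    have h1 : HasDerivAt (fun t : ℝ => fderiv ℝ φ (x + t • (x - c)) (x - c))
        (fderiv ℝ (fderiv ℝ φ) x (x - c) (x - c)) 0 := by
      have h := (HasFDerivAt.comp_hasDerivAt (x := (0 : ℝ)) (l := fderiv ℝ φ)
        (l' := fderiv ℝ (fderiv ℝ φ) x) (by simpa using hd) hline)
      simpa using h.clm_apply (hasDerivAt_const (0 : ℝ) (x - c))
    have h2 : HasDerivAt (fun t : ℝ => F' ((1 + t) * ‖x - c‖) * ‖x - c‖)
        (F'' ‖x - c‖ * ‖x - c‖ * ‖x - c‖) 0 := by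
      have h3 : HasDerivAt (fun t : ℝ => (1 + t) * ‖x - c‖) ‖x - c‖ 0 := by
        simpa using (((hasDerivAt_id (0 : ℝ)).const_add 1).mul_const ‖x - c‖)
      have h4 : HasDerivAt F' (F'' ‖x - c‖) ((1 + 0) * ‖x - c‖) := by
        simpa using hF' ‖x - c‖
      exact (h4.comp (0 : ℝ) h3).mul_const _
    have h5 : (fun t : ℝ => fderiv ℝ φ (x + t • (x - c)) (x - c)) =ᶠ[𝓝 0]
        fun t : ℝ => F' ((1 + t) * ‖x - c‖) * ‖x - c‖ := by
      filter_upwards [eventually_gt_nhds (show (-1 : ℝ) < 0 by norm_num)] with t ht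
      have ht' : 0 < 1 + t := by linarith
      have e1 : x + t • (x - c) - c = (1 + t) • (x - c) := by module
      have e2 : ‖x + t • (x - c) - c‖ = (1 + t) * ‖x - c‖ := by
        rw [e1, norm_smul, Real.norm_of_nonneg ht'.le]
      have hne' : x + t • (x - c) ≠ c := by
        rw [← sub_ne_zero, ← norm_ne_zero_iff, e2]
        positivity
      rw [(hfd _ hne').fderiv, e2, e1]
      simp only [map_smul, smul_apply, innerSL_apply_apply, real_inner_self_eq_norm_sq, smul_eq_mul]
      field_simp
    rw [h1.unique (h2.congr_of_eventuallyEq h5)]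
    ring
  have hg0 : gradient φ x ≠ 0 := by
    rw [hgrad]
    exact smul_ne_zero (div_ne_zero hne hr.ne') (sub_ne_zero.2 hx)
  rw [laplInfPlus, if_neg hg0, secondDeriv_eq_fderiv, hgrad]
  simp only [map_smul, smul_apply, hB, norm_smul, smul_eq_mul]
  rw [Real.norm_eq_abs, mul_pow, sq_abs]
  field_simp

/-- Second-order Taylor bound from above in one variable. -/
theorem eventually_le_quadratic {F F' F'' : ℝ → ℝ}
    (hF : ∀ t, HasDerivAt F (F' t) t) (hF' : ∀ t, HasDerivAt F' (F'' t) t) {ρ κ : ℝ}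
    (hκ : F'' ρ < κ) :
    ∀ᶠ t in 𝓝 ρ, F t ≤ F ρ + F' ρ * (t - ρ) + κ / 2 * (t - ρ) ^ 2 := by
  let g : ℝ → ℝ := fun t => F ρ + F' ρ * (t - ρ) + κ / 2 * (t - ρ) ^ 2 - F t
  have hg : ∀ t, HasDerivAt g (F' ρ + κ * (t - ρ) - F' t) t := fun t => by
    have h0 := (hasDerivAt_id t).sub_const ρ
    refine ((((h0.const_mul (F' ρ)).const_add (F ρ)).add
      ((h0.pow 2).const_mul (κ / 2))).sub (hF t)).congr_deriv ?_
    simp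
    ring
  have hg' : HasDerivAt (deriv g) (κ - F'' ρ) ρ := by
    rw [show deriv g = fun t => F' ρ + κ * (t - ρ) - F' t from funext fun t => (hg t).deriv]
    refine (((((hasDerivAt_id ρ).sub_const ρ).const_mul κ).const_add (F' ρ)).sub
      (hF' ρ)).congr_deriv ?_
    simp
  have hmin : IsLocalMin g ρ := isLocalMin_of_deriv_deriv_pos
    (by rw [hg'.deriv]; linarith) (by rw [(hg ρ).deriv]; ring) (hg ρ).continuousAt
  filter_upwards [hmin] with t ht
  simp only [g, sub_self] at ht
  linarith

/-- The viscosity inequality at a maximum point of the doubled functional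
`u(x) - F(|y - x₀|) - k|x - y|⁴`. -/
theorem SubPair.sub_le_of_doubling {n : ℕ} (hn : 1 ≤ n) {U : Set (EuclideanSpace ℝ (Fin n))}
    {u v : EuclideanSpace ℝ (Fin n) → ℝ} (hu : SubPair U u v)
    {x₀ : EuclideanSpace ℝ (Fin n)} {r : ℝ} (hK : closedBall x₀ r ⊆ U) {F F' F'' : ℝ → ℝ}
    (hF : ∀ t, HasDerivAt F (F' t) t) (hF' : ∀ t, HasDerivAt F' (F'' t) t)
    (hF'' : Continuous F'') {k : ℝ} (hk : 0 < k) {x y : EuclideanSpace ℝ (Fin n)}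
    (hx : x ∈ ball x₀ r) (hy : y ∈ ball x₀ r) (hy₀ : y ≠ x₀)
    (hmax : ∀ x' ∈ closedBall x₀ r, ∀ y' ∈ closedBall x₀ r,
      u x' - F ‖y' - x₀‖ - k * ‖x' - y'‖ ^ 4 ≤ u x - F ‖y - x₀‖ - k * ‖x - y‖ ^ 4) :
    u x - v x ≤ F'' ‖y - x₀‖ := by
  have hxU : x ∈ U := hK (ball_subset_closedBall hx)
  by_cases hne : F' ‖y - x₀‖ = 0
  · have hxy : x = y := by
      by_contra hxy
      have hline : HasDerivAt (fun t : ℝ => y + t • (x - y)) (x - y) 0 := by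
        simpa using ((hasDerivAt_id (0 : ℝ)).smul_const (x - y)).const_add y
      have h1 : HasFDerivAt (fun z => F ‖z - x₀‖) (0 : EuclideanSpace ℝ (Fin n) →L[ℝ] ℝ) y :=
        (hasFDerivAt_comp_norm_sub (hF _) hy₀).congr_fderiv (by simp [hne])
      have h2 : HasDerivAt (fun t : ℝ => F ‖y + t • (x - y) - x₀‖) 0 0 := by
        exact HasFDerivAt.comp_hasDerivAt (x := (0 : ℝ)) (l := fun z => F ‖z - x₀‖)
          (l' := 0) (by simpa using h1) hline
      have h3 : HasDerivAt (fun t : ℝ => k * ((1 - t) ^ 4 * ‖x - y‖ ^ 4))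
          (-(4 * k * ‖x - y‖ ^ 4)) 0 := by
        refine (((((hasDerivAt_id (0 : ℝ)).const_sub 1).pow 4).mul_const
          (‖x - y‖ ^ 4)).const_mul k).congr_deriv ?_
        simp
        ring
      have hmin : IsLocalMin (fun t : ℝ => F ‖y + t • (x - y) - x₀‖ +
          k * ((1 - t) ^ 4 * ‖x - y‖ ^ 4)) 0 := by
        have hev : ∀ᶠ t : ℝ in 𝓝 0, y + t • (x - y) ∈ ball x₀ r :=
          hline.continuousAt (by simpa using isOpen_ball.mem_nhds hy)
        filter_upwards [hev] with t ht
        have h := hmax x (ball_subset_closedBall hx) _ (ball_subset_closedBall ht)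
        have e : ‖x - (y + t • (x - y))‖ ^ 4 = (1 - t) ^ 4 * ‖x - y‖ ^ 4 := by
          rw [show x - (y + t • (x - y)) = (1 - t) • (x - y) by module, norm_smul, mul_pow,
            Real.norm_eq_abs, Even.pow_abs (by decide)]
        rw [e] at h
        simp only [zero_smul, add_zero, sub_zero, one_pow, one_mul]
        linarith
      have h4 := hmin.hasDerivAt_eq_zero (h2.add h3)
      have : 0 < ‖x - y‖ := norm_pos_iff.2 (sub_ne_zero.2 hxy)
      have : 0 < 4 * k * ‖x - y‖ ^ 4 := by positivity
      linarith
    subst hxy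
    have hρ : 0 < ‖x - x₀‖ := norm_pos_iff.2 (sub_ne_zero.2 hy₀)
    by_contra! hlt
    obtain ⟨κ, hκ, hκ'⟩ := exists_between hlt
    have hquad := eventually_le_quadratic hF hF' hκ
    simp only [hne, zero_mul, add_zero] at hquad
    have hκ0 : 0 ≤ κ := by
      have hline : Tendsto (fun t : ℝ => x + t • (x - x₀)) (𝓝[≠] 0) (𝓝 x) := by
        have h : Continuous (fun t : ℝ => x + t • (x - x₀)) := by fun_prop
        simpa using (h.tendsto 0).mono_left nhdsWithin_le_nhds
      have hnorm : Tendsto (fun t : ℝ => ‖x + t • (x - x₀) - x₀‖) (𝓝[≠] 0) (𝓝 ‖x - x₀‖) :=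
        (hline.sub_const x₀).norm
      have hlim : Tendsto (fun t : ℝ => κ / 2 + k * (t ^ 2 * ‖x - x₀‖ ^ 2)) (𝓝[≠] 0)
          (𝓝 (κ / 2)) := by
        have h : Continuous (fun t : ℝ => κ / 2 + k * (t ^ 2 * ‖x - x₀‖ ^ 2)) := by fun_prop
        simpa using (h.tendsto 0).mono_left nhdsWithin_le_nhds
      have h0 : 0 ≤ κ / 2 := by
        refine ge_of_tendsto hlim ?_
        filter_upwards [hline.eventually (isOpen_ball.mem_nhds hx), hnorm.eventually hquad,
          self_mem_nhdsWithin, nhdsWithin_le_nhds (eventually_gt_nhds (show (-1 : ℝ) < 0 by norm_num))]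
          with t ht1 ht2 ht3 ht4
        have h := hmax x (ball_subset_closedBall hx) _ (ball_subset_closedBall ht1)
        have e1 : ‖x + t • (x - x₀) - x₀‖ = (1 + t) * ‖x - x₀‖ := by
          rw [show x + t • (x - x₀) - x₀ = (1 + t) • (x - x₀) by module, norm_smul,
            Real.norm_of_nonneg (by linarith)]
        have e2 : ‖x - (x + t • (x - x₀))‖ ^ 4 = t ^ 4 * ‖x - x₀‖ ^ 4 := by
          rw [show x - (x + t • (x - x₀)) = (-t) • (x - x₀) by module, norm_smul, mul_pow,
            Real.norm_eq_abs, Even.pow_abs (by decide)]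
          ring
        rw [e2] at h
        rw [e1] at h ht2
        simp only [sub_self, norm_zero] at h
        have ht0 : t ≠ 0 := ht3
        have hpos : 0 < t ^ 2 * ‖x - x₀‖ ^ 2 := by positivity
        have : 0 ≤ (κ / 2 + k * (t ^ 2 * ‖x - x₀‖ ^ 2)) * (t ^ 2 * ‖x - x₀‖ ^ 2) := by
          nlinarith
        exact nonneg_of_mul_nonneg_left this hpos
      linarith
    have hφ : ContDiff ℝ 2 (fun z => F ‖x - x₀‖ + κ / 2 * ‖z - x‖ ^ 2) :=
      contDiff_const.add (contDiff_const.mul ((contDiff_id.sub contDiff_const).norm_sq ℝ))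
    have htest := hu.le_of_contDiffAt hxU hφ.contDiffAt (by
      have hnorm : Tendsto (fun z => ‖z - x₀‖) (𝓝 x) (𝓝 ‖x - x₀‖) :=
        (tendsto_id.sub_const x₀).norm
      filter_upwards [isOpen_ball.mem_nhds hx, hnorm.eventually hquad] with z hz1 hz2
      have h := hmax z (ball_subset_closedBall hz1) z (ball_subset_closedBall hz1)
      have hsq : (‖z - x₀‖ - ‖x - x₀‖) ^ 2 ≤ ‖z - x‖ ^ 2 := by
        rw [← sq_abs]
        gcongr
        simpa using abs_norm_sub_norm_le (z - x₀) (x - x₀)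
      simp only [sub_self, norm_zero] at h ⊢
      nlinarith)
    rw [laplInfPlus_half_mul_norm_sub_sq hn] at htest
    linarith
  · have e : x - (x₀ - (y - x)) = y - x₀ := by abel
    obtain ⟨h1, h2⟩ := laplInfPlus_comp_norm_sub hF hF' hF'' (c := x₀ - (y - x)) (x := x)
      (by rw [← sub_ne_zero, e]; exact sub_ne_zero.2 hy₀) (by rwa [e])
    rw [e] at h2
    rw [← h2]
    refine hu.le_of_contDiffAt hxU h1 ?_
    have hc : Continuous fun z : EuclideanSpace ℝ (Fin n) => z + (y - x) := by fun_prop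
    have hev : ∀ᶠ z in 𝓝 x, z + (y - x) ∈ ball x₀ r :=
      hc.continuousAt (by simpa using isOpen_ball.mem_nhds hy)
    filter_upwards [isOpen_ball.mem_nhds hx, hev] with z hz1 hz2
    have h := hmax z (ball_subset_closedBall hz1) _ (ball_subset_closedBall hz2)
    rw [show z - (z + (y - x)) = x - y by abel, show z + (y - x) - x₀ = z - (x₀ - (y - x)) by abel]
      at h
    rw [e]
    linarith

/-- A subsolution minus a strict radial supersolution has no interior maximum. -/
theorem SubPair.not_exists_max_sub_radial {n : ℕ} (hn : 1 ≤ n)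
    {U : Set (EuclideanSpace ℝ (Fin n))} {u v : EuclideanSpace ℝ (Fin n) → ℝ}
    (hu : SubPair U u v) {x₀ : EuclideanSpace ℝ (Fin n)} {r : ℝ} (hK : closedBall x₀ r ⊆ U)
    (cu : ContinuousOn u (closedBall x₀ r)) (cv : ContinuousOn v (closedBall x₀ r))
    {F F' F'' : ℝ → ℝ}
    (hF : ∀ t, HasDerivAt F (F' t) t) (hF' : ∀ t, HasDerivAt F' (F'' t) t)
    (hF'' : Continuous F'') {M : ℝ}
    (hbd : ∀ x ∈ sphere x₀ r ∪ {x₀}, u x - F ‖x - x₀‖ < M)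
    (hmax : ∀ x ∈ closedBall x₀ r, u x - F ‖x - x₀‖ ≤ M)
    (hstrict : ∀ x ∈ closedBall x₀ r, u x - F ‖x - x₀‖ = M → F'' ‖x - x₀‖ < u x - v x) :
    ¬ ∃ x ∈ closedBall x₀ r, u x - F ‖x - x₀‖ = M := by
  rintro ⟨z, hz, hzM⟩
  have hFc : Continuous F := continuous_iff_continuousAt.2 fun t => (hF t).continuousAt
  set K := closedBall x₀ r with hKdef
  have hKc : IsCompact K := isCompact_closedBall x₀ r
  have hex : ∀ k : ℕ, ∃ p ∈ K ×ˢ K, ∀ q ∈ K ×ˢ K,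
      u q.1 - F ‖q.2 - x₀‖ - k * ‖q.1 - q.2‖ ^ 4 ≤
        u p.1 - F ‖p.2 - x₀‖ - k * ‖p.1 - p.2‖ ^ 4 := fun k => by
    have hc : ContinuousOn (fun q : EuclideanSpace ℝ (Fin n) × EuclideanSpace ℝ (Fin n) =>
        u q.1 - F ‖q.2 - x₀‖ - k * ‖q.1 - q.2‖ ^ 4) (K ×ˢ K) := by
      refine ((cu.comp continuousOn_fst fun q hq => hq.1).sub ?_).sub ?_
      · exact (hFc.comp (by fun_prop : Continuous fun
          q : EuclideanSpace ℝ (Fin n) × EuclideanSpace ℝ (Fin n) => ‖q.2 - x₀‖)).continuousOn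
      · fun_prop
    obtain ⟨p, hp, h⟩ := (hKc.prod hKc).exists_isMaxOn ⟨(z, z), hz, hz⟩ hc
    exact ⟨p, hp, fun q hq => h hq⟩
  choose p hpK hp using hex
  obtain ⟨⟨a, b⟩, hab, s, hs, hlim⟩ := (hKc.prod hKc).tendsto_subseq hpK
  have ha : Tendsto (fun j => (p (s j)).1) atTop (𝓝 a) := (continuous_fst.tendsto _).comp hlim
  have hb : Tendsto (fun j => (p (s j)).2) atTop (𝓝 b) := (continuous_snd.tendsto _).comp hlim
  have haW : Tendsto (fun j => (p (s j)).1) atTop (𝓝[K] a) :=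
    tendsto_nhdsWithin_iff.2 ⟨ha, Eventually.of_forall fun j => (hpK _).1⟩
  have hua : Tendsto (fun j => u (p (s j)).1) atTop (𝓝 (u a)) := (cu a hab.1).tendsto.comp haW
  have hva : Tendsto (fun j => v (p (s j)).1) atTop (𝓝 (v a)) := (cv a hab.1).tendsto.comp haW
  have hnb : Tendsto (fun j => ‖(p (s j)).2 - x₀‖) atTop (𝓝 ‖b - x₀‖) := (hb.sub_const x₀).norm
  have hFb : Tendsto (fun j => F ‖(p (s j)).2 - x₀‖) atTop (𝓝 (F ‖b - x₀‖)) :=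
    (hFc.tendsto _).comp hnb
  have hge : ∀ k : ℕ, k * ‖(p k).1 - (p k).2‖ ^ 4 ≤ u (p k).1 - F ‖(p k).2 - x₀‖ - M := by
    intro k
    have := hp k (z, z) ⟨hz, hz⟩
    simp only [sub_self, norm_zero] at this
    linarith
  have hsM : M ≤ u a - F ‖b - x₀‖ := by
    refine ge_of_tendsto (hua.sub hFb) (Eventually.of_forall fun j => ?_)
    have h1 := hge (s j)
    have h2 : (0 : ℝ) ≤ (s j : ℕ) * ‖(p (s j)).1 - (p (s j)).2‖ ^ 4 := by positivity
    linarith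
  have heq : a = b := by
    by_contra hne
    have hpos : 0 < ‖a - b‖ ^ 4 := by
      have := norm_pos_iff.2 (sub_ne_zero.2 hne)
      positivity
    have h1 : Tendsto (fun j => ((s j : ℕ) : ℝ) * ‖(p (s j)).1 - (p (s j)).2‖ ^ 4) atTop atTop :=
      (tendsto_natCast_atTop_atTop.comp hs.tendsto_atTop).atTop_mul_pos hpos
        (((ha.sub hb).norm).pow 4)
    have h2 := tendsto_atTop_mono (fun j => hge (s j)) h1
    exact not_tendsto_nhds_of_tendsto_atTop h2 _ ((hua.sub hFb).sub_const M)
  subst heq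
  have haM : u a - F ‖a - x₀‖ = M := le_antisymm (hmax a hab.1) hsM
  have hnot : a ∉ sphere x₀ r ∪ {x₀} := fun h => (hbd a h).ne haM
  have haball : a ∈ ball x₀ r :=
    mem_ball.2 (lt_of_le_of_ne hab.1 fun h => hnot (Or.inl h))
  have ha0 : a ≠ x₀ := fun h => hnot (Or.inr h)
  have hlt : ∀ᶠ j in atTop, F'' ‖(p (s j)).2 - x₀‖ < u (p (s j)).1 - v (p (s j)).1 :=
    ((hF''.tendsto _).comp hnb).eventually_lt (hua.sub hva) (hstrict a hab.1 haM)
  obtain ⟨j, hj1, hj2, hj3, hj4, hj5⟩ := (hlt.and ((ha.eventually (isOpen_ball.mem_nhds haball)).and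
    ((hb.eventually (isOpen_ball.mem_nhds haball)).and ((hb.eventually_ne ha0).and
      (hs.tendsto_atTop.eventually_gt_atTop 0))))).exists
  have := hu.sub_le_of_doubling hn hK hF hF' hF'' (k := (s j : ℕ)) (by exact_mod_cast hj5)
    hj2 hj3 hj4 (fun x' hx' y' hy' => hp (s j) (x', y') ⟨hx', hy'⟩)
  linarith

/-- Radial profile of the first component of a generalized cone, perturbed by a concave
parabola vanishing at `r`. -/
noncomputable def perturbedConeProfile (C₁ C₂ a b ε r t : ℝ) : ℝ :=
  C₁ * Real.exp (Real.sqrt 2 * t) + C₂ * Real.exp (-(Real.sqrt 2 * t)) + a * t + b +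
    ε * (r ^ 2 - t ^ 2)

theorem cone₂_eq_cone₁_neg {n : ℕ} (x₀ : EuclideanSpace ℝ (Fin n)) (C₁ C₂ a b : ℝ) :
    cone₂ x₀ C₁ C₂ a b = cone₁ x₀ (-C₁) (-C₂) a b := by
  ext x
  simp only [cone₁, cone₂]
  ring

theorem ComparisonAbove.symm {n : ℕ} {U : Set (EuclideanSpace ℝ (Fin n))}
    {u₁ u₂ : EuclideanSpace ℝ (Fin n) → ℝ} (h : ComparisonAbove U u₁ u₂) :
    ComparisonAbove U u₂ u₁ := by
  intro x₀ hx₀ r hr hK C₁ C₂ a b hbd x hx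
  have key := h x₀ hx₀ r hr hK (-C₁) (-C₂) a b
  simp only [cone₂_eq_cone₁_neg, neg_neg] at key hbd ⊢
  exact (key (fun y hy => (hbd y hy).symm) x hx).symm

/-- If `(u₁, u₂)` is a subsolution, the first component does not attain a positive common
maximum of the differences with a perturbed generalized cone pair. -/
theorem SubPair.sub_perturbedConeProfile_ne {n : ℕ} (hn : 1 ≤ n)
    {U : Set (EuclideanSpace ℝ (Fin n))} {u v : EuclideanSpace ℝ (Fin n) → ℝ}
    (hu : SubPair U u v) {x₀ : EuclideanSpace ℝ (Fin n)} {r : ℝ} (hK : closedBall x₀ r ⊆ U)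
    (cu : ContinuousOn u (closedBall x₀ r)) (cv : ContinuousOn v (closedBall x₀ r))
    {C₁ C₂ a b ε M : ℝ} (hε : 0 < ε) (hM : 0 < M)
    (hbd : ∀ x ∈ sphere x₀ r ∪ {x₀}, u x ≤ cone₁ x₀ C₁ C₂ a b x)
    (hmu : ∀ x ∈ closedBall x₀ r, u x - perturbedConeProfile C₁ C₂ a b ε r ‖x - x₀‖ ≤ M)
    (hmv : ∀ x ∈ closedBall x₀ r, v x - perturbedConeProfile (-C₁) (-C₂) a b ε r ‖x - x₀‖ ≤ M)
    {z : EuclideanSpace ℝ (Fin n)} (hz : z ∈ closedBall x₀ r) :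
    u z - perturbedConeProfile C₁ C₂ a b ε r ‖z - x₀‖ ≠ M := by
  have hsq : Real.sqrt 2 * Real.sqrt 2 = 2 := Real.mul_self_sqrt zero_le_two
  have hexp : ∀ t, HasDerivAt (fun t => Real.exp (Real.sqrt 2 * t))
      (Real.sqrt 2 * Real.exp (Real.sqrt 2 * t)) t := fun t => by
    refine (((hasDerivAt_id t).const_mul (Real.sqrt 2)).exp).congr_deriv ?_
    simp
    ring
  have hexp' : ∀ t, HasDerivAt (fun t => Real.exp (-(Real.sqrt 2 * t)))
      (-(Real.sqrt 2 * Real.exp (-(Real.sqrt 2 * t)))) t := fun t => by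
    refine (((hasDerivAt_id t).const_mul (Real.sqrt 2)).neg.exp).congr_deriv ?_
    simp
    ring
  intro hzM
  refine hu.not_exists_max_sub_radial hn hK cu cv (F := perturbedConeProfile C₁ C₂ a b ε r)
    (F' := fun t => C₁ * (Real.sqrt 2 * Real.exp (Real.sqrt 2 * t)) -
      C₂ * (Real.sqrt 2 * Real.exp (-(Real.sqrt 2 * t))) + a - 2 * ε * t)
    (F'' := fun t => 2 * C₁ * Real.exp (Real.sqrt 2 * t) +
      2 * C₂ * Real.exp (-(Real.sqrt 2 * t)) - 2 * ε) (fun t => ?_) (fun t => ?_)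
    (by fun_prop) ?_ hmu ?_ ⟨z, hz, hzM⟩
  · refine ((((((hexp t).const_mul C₁).add ((hexp' t).const_mul C₂)).add
      ((hasDerivAt_id t).const_mul a)).add_const b).add
      ((((hasDerivAt_id t).pow 2).const_sub (r ^ 2)).const_mul ε)).congr_deriv ?_
    simp
    ring
  · refine ((((((hexp t).const_mul (Real.sqrt 2)).const_mul C₁).sub
      (((hexp' t).const_mul (Real.sqrt 2)).const_mul C₂)).add_const a).sub
      ((hasDerivAt_id t).const_mul (2 * ε))).congr_deriv ?_
    linear_combination (C₁ * Real.exp (Real.sqrt 2 * t) +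
      C₂ * Real.exp (-(Real.sqrt 2 * t))) * hsq
  · intro x hx
    have h1 := hbd x hx
    have h2 : 0 ≤ r ^ 2 - ‖x - x₀‖ ^ 2 := by
      rcases hx with hx | hx
      · rw [mem_sphere_iff_norm.1 hx, sub_self]
      · rw [mem_singleton_iff.1 hx]
        simp [sq_nonneg]
    have h3 := mul_nonneg hε.le h2
    simp only [cone₁] at h1
    simp only [perturbedConeProfile]
    linarith
  · intro x hx hxM
    have h1 := hmv x hx
    simp only [perturbedConeProfile] at h1 hxM ⊢
    linarith

theorem IsSubsolution.comparisonAbove {n : ℕ} (hn : 1 ≤ n)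
    {U : Set (EuclideanSpace ℝ (Fin n))} {u₁ u₂ : EuclideanSpace ℝ (Fin n) → ℝ}
    (h : IsSubsolution U u₁ u₂) (hu₁ : ContinuousOn u₁ U) (hu₂ : ContinuousOn u₂ U) :
    ComparisonAbove U u₁ u₂ := by
  obtain ⟨-, -, h₁, h₂⟩ := h
  intro x₀ _ r hr hK C₁ C₂ a b hbd
  have c₁ := hu₁.mono hK
  have c₂ := hu₂.mono hK
  have key : ∀ ε : ℝ, 0 < ε → ∀ x ∈ closedBall x₀ r,
      max (u₁ x - perturbedConeProfile C₁ C₂ a b ε r ‖x - x₀‖)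
        (u₂ x - perturbedConeProfile (-C₁) (-C₂) a b ε r ‖x - x₀‖) ≤ 0 := by
    intro ε hε
    have hcont : ∀ D₁ D₂ : ℝ, Continuous fun x : EuclideanSpace ℝ (Fin n) =>
        perturbedConeProfile D₁ D₂ a b ε r ‖x - x₀‖ := fun D₁ D₂ => by
      simp only [perturbedConeProfile]
      fun_prop
    have hc : ContinuousOn (fun x => max (u₁ x - perturbedConeProfile C₁ C₂ a b ε r ‖x - x₀‖)
        (u₂ x - perturbedConeProfile (-C₁) (-C₂) a b ε r ‖x - x₀‖)) (closedBall x₀ r) :=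
      ContinuousOn.sup (c₁.sub (hcont C₁ C₂).continuousOn)
        (c₂.sub (hcont (-C₁) (-C₂)).continuousOn)
    obtain ⟨z, hz, hmax⟩ := (isCompact_closedBall x₀ r).exists_isMaxOn
      ⟨x₀, mem_closedBall_self hr.le⟩ hc
    by_contra! hcon
    obtain ⟨x, hx, hpos⟩ := hcon
    have hM := hpos.trans_le (hmax hx)
    have hmax' := isMaxOn_iff.1 hmax
    have hm₁ := fun y hy => (le_max_left _ _).trans (hmax' y hy)
    have hm₂ := fun y hy => (le_max_right _ _).trans (hmax' y hy)
    rcases max_choice (u₁ z - perturbedConeProfile C₁ C₂ a b ε r ‖z - x₀‖)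
      (u₂ z - perturbedConeProfile (-C₁) (-C₂) a b ε r ‖z - x₀‖) with hz' | hz'
    · exact h₁.sub_perturbedConeProfile_ne hn hK c₁ c₂ hε hM (fun y hy => (hbd y hy).1)
        hm₁ hm₂ hz hz'.symm
    · exact h₂.sub_perturbedConeProfile_ne hn hK c₂ c₁ hε hM
        (fun y hy => cone₂_eq_cone₁_neg x₀ C₁ C₂ a b ▸ (hbd y hy).2)
        hm₂ (by simpa only [neg_neg] using hm₁) hz hz'.symm
  intro x hx
  have hlim : ∀ D₁ D₂ : ℝ, Tendsto (fun ε : ℝ => perturbedConeProfile D₁ D₂ a b ε r ‖x - x₀‖)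
      (𝓝[>] 0) (𝓝 (cone₁ x₀ D₁ D₂ a b x)) := fun D₁ D₂ => by
    have hc : Continuous (fun ε : ℝ => perturbedConeProfile D₁ D₂ a b ε r ‖x - x₀‖) := by
      simp only [perturbedConeProfile]
      fun_prop
    simpa [perturbedConeProfile, cone₁] using (hc.tendsto 0).mono_left nhdsWithin_le_nhds
  rw [cone₂_eq_cone₁_neg]
  constructor
  · refine ge_of_tendsto (hlim C₁ C₂) ?_
    filter_upwards [self_mem_nhdsWithin] with ε hε
    linarith [(le_max_left _ _).trans (key ε hε x hx)]
  · refine ge_of_tendsto (hlim (-C₁) (-C₂)) ?_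
    filter_upwards [self_mem_nhdsWithin] with ε hε
    linarith [(le_max_right _ _).trans (key ε hε x hx)]

/-- Second-order Taylor bound from above. -/
theorem ContDiffAt.eventually_le_taylor_two {n : ℕ} {φ : EuclideanSpace ℝ (Fin n) → ℝ}
    {x : EuclideanSpace ℝ (Fin n)} (hφ : ContDiffAt ℝ 2 φ x) {η : ℝ} (hη : 0 < η) :
    ∀ᶠ y in 𝓝 x, φ y ≤ φ x + fderiv ℝ φ x (y - x) +
      1 / 2 * (fderiv ℝ (fderiv ℝ φ) x (y - x) (y - x) + η * ‖y - x‖ ^ 2) := by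
  have hd : HasFDerivAt (fderiv ℝ φ) (fderiv ℝ (fderiv ℝ φ) x) x :=
    ((hφ.fderiv_right (m := 1) (by norm_num)).differentiableAt (by simp)).hasFDerivAt
  have hdiff : ∀ᶠ y in 𝓝 x, DifferentiableAt ℝ φ y :=
    (hφ.eventually (by simp)).mono fun y hy => hy.differentiableAt (by simp)
  obtain ⟨δ, hδ, hball⟩ := Metric.eventually_nhds_iff_ball.1
    (hdiff.and (hd.isLittleO.bound hη))
  filter_upwards [ball_mem_nhds x hδ] with y hy
  set h := y - x with hh
  set B := fderiv ℝ (fderiv ℝ φ) x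
  let g : ℝ → ℝ := fun t => φ (x + t • h) - (t * fderiv ℝ φ x h +
    t ^ 2 * (1 / 2 * (B h h + η * ‖h‖ ^ 2)))
  have hmem : ∀ t ∈ Icc (0 : ℝ) 1, x + t • h ∈ ball x δ := by
    intro t ht
    rw [mem_ball_iff_norm] at hy ⊢
    rw [add_sub_cancel_left, norm_smul, Real.norm_of_nonneg ht.1]
    exact (mul_le_of_le_one_left (norm_nonneg _) ht.2).trans_lt hy
  have hg : ∀ t ∈ Icc (0 : ℝ) 1, HasDerivAt g (fderiv ℝ φ (x + t • h) h -
      (fderiv ℝ φ x h + t * (B h h + η * ‖h‖ ^ 2))) t := by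
    intro t ht
    have hline : HasDerivAt (fun t : ℝ => x + t • h) h t := by
      simpa using ((hasDerivAt_id t).smul_const h).const_add x
    refine (((hball _ (hmem t ht)).1.hasFDerivAt.comp_hasDerivAt t hline).sub
      (((hasDerivAt_id t).mul_const (fderiv ℝ φ x h)).add
      (((hasDerivAt_id t).pow 2).mul_const (1 / 2 * (B h h + η * ‖h‖ ^ 2))))).congr_deriv ?_
    simp
    ring
  have hanti : AntitoneOn g (Icc 0 1) := by
    refine antitoneOn_of_deriv_nonpos (convex_Icc 0 1)
      (fun t ht => (hg t ht).continuousAt.continuousWithinAt)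
      (fun t ht => (hg t (interior_subset ht)).differentiableAt.differentiableWithinAt)
      fun t ht => ?_
    have ht := interior_subset ht
    rw [(hg t ht).deriv]
    have h1 := (hball _ (hmem t ht)).2
    rw [add_sub_cancel_left, norm_smul, Real.norm_of_nonneg ht.1] at h1
    have h2 := (le_abs_self _).trans (((fderiv ℝ φ (x + t • h) - fderiv ℝ φ x -
      B (t • h)).le_opNorm h).trans (mul_le_mul_of_nonneg_right h1 (norm_nonneg h)))
    simp only [sub_apply, map_smul, smul_apply, smul_eq_mul] at h2
    linarith
  have h01 := hanti (left_mem_Icc.2 zero_le_one) (right_mem_Icc.2 zero_le_one) zero_le_one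
  simp only [g, one_smul, zero_smul, add_zero, one_pow, one_mul, zero_mul, sub_zero,
    zero_pow two_ne_zero, hh, add_sub_cancel] at h01
  linarith

theorem sq_le_cosh_sqrt_two_mul_sub_one {t : ℝ} (ht : 0 ≤ t) :
    t ^ 2 ≤ Real.cosh (Real.sqrt 2 * t) - 1 := by
  have h2 : Real.sqrt 2 ^ 2 = 2 := Real.sq_sqrt zero_le_two
  have h0 : 0 ≤ Real.sqrt 2 * t / 2 := by positivity
  have h1 := Real.self_le_sinh_iff.2 h0
  have h3 := pow_le_pow_left₀ h0 h1 2
  rw [show Real.sqrt 2 * t = 2 * (Real.sqrt 2 * t / 2) by ring, Real.cosh_two_mul, Real.cosh_sq]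
  have h4 : (Real.sqrt 2 * t / 2) ^ 2 = t ^ 2 / 2 := by
    rw [div_pow, mul_pow, h2]
    ring
  linarith

theorem cosh_sqrt_two_mul_sub_one_le {t : ℝ} (ht : 0 ≤ t) (ht1 : t ≤ 1) :
    Real.cosh (Real.sqrt 2 * t) - 1 ≤ t ^ 2 + t ^ 4 := by
  have h2 : Real.sqrt 2 ^ 2 = 2 := Real.sq_sqrt zero_le_two
  have h1 := Real.cosh_le_exp_half_sq (Real.sqrt 2 * t)
  rw [mul_pow, h2, mul_div_cancel_left₀ _ two_ne_zero] at h1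
  have h3 := Real.abs_exp_sub_one_sub_id_le (x := t ^ 2)
    (by rw [abs_of_nonneg (by positivity)]; exact pow_le_one₀ ht ht1)
  have h4 := (abs_le.1 h3).2
  nlinarith

theorem cone₁_quarter {n : ℕ} (x₀ : EuclideanSpace ℝ (Fin n)) (c a b : ℝ)
    (x : EuclideanSpace ℝ (Fin n)) :
    cone₁ x₀ (c / 4) (c / 4) a b x =
      c / 2 * Real.cosh (Real.sqrt 2 * ‖x - x₀‖) + a * ‖x - x₀‖ + b := by
  rw [cone₁, Real.cosh_eq]
  ring

theorem cone₂_quarter {n : ℕ} (x₀ : EuclideanSpace ℝ (Fin n)) (c a b : ℝ)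
    (x : EuclideanSpace ℝ (Fin n)) :
    cone₂ x₀ (c / 4) (c / 4) a b x =
      -(c / 2) * Real.cosh (Real.sqrt 2 * ‖x - x₀‖) + a * ‖x - x₀‖ + b := by
  rw [cone₂, Real.cosh_eq]
  ring

/-- Comparison with the cone pair with `C₁ = C₂ = c / 4` whose first component is `q` at the vertex
`y` and `m` on the sphere of radius `r`. -/
theorem ComparisonAbove.le_of_sphere {n : ℕ} {U : Set (EuclideanSpace ℝ (Fin n))}
    {u₁ u₂ : EuclideanSpace ℝ (Fin n) → ℝ} (h : ComparisonAbove U u₁ u₂)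
    {y : EuclideanSpace ℝ (Fin n)} {r c m q : ℝ} (hr : 0 < r) (hK : closedBall y r ⊆ U)
    (hy₁ : u₁ y ≤ q) (hy₂ : u₂ y ≤ q - c) (hs₁ : ∀ x ∈ sphere y r, u₁ x ≤ m)
    (hs₂ : ∀ x ∈ sphere y r, u₂ x ≤ m - c * Real.cosh (Real.sqrt 2 * r))
    {x : EuclideanSpace ℝ (Fin n)} (hx : x ∈ closedBall y r) :
    u₁ x ≤ c / 2 * (Real.cosh (Real.sqrt 2 * ‖x - y‖) - 1) +
      (m - q - c / 2 * (Real.cosh (Real.sqrt 2 * r) - 1)) / r * ‖x - y‖ + q := by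
  have key := (h y (hK (mem_closedBall_self hr.le)) r hr hK (c / 4) (c / 4)
    ((m - q - c / 2 * (Real.cosh (Real.sqrt 2 * r) - 1)) / r) (q - c / 2) ?_ x hx).1
  · rw [cone₁_quarter] at key
    linarith
  · rintro z (hz | hz)
    · rw [cone₁_quarter, cone₂_quarter, mem_sphere_iff_norm.1 hz, div_mul_cancel₀ _ hr.ne']
      exact ⟨by linarith [hs₁ z hz], by linarith [hs₂ z hz]⟩
    · rw [mem_singleton_iff.1 hz, cone₁_quarter, cone₂_quarter]
      simp only [sub_self, norm_zero, mul_zero, Real.cosh_zero]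
      exact ⟨by linarith, by linarith⟩

theorem le_add_of_cone_estimate {r c P s N H H' α β γ δ : ℝ} (hr : 0 < r) (hr1 : r ≤ 1)
    (hα : |α| ≤ N) (hβ : |β| ≤ N) (hγ : |γ| ≤ N) (hH : r ^ 2 ≤ H) (hH2 : H ≤ r ^ 2 + r ^ 4)
    (hH' : (r ^ 3) ^ 2 ≤ H') (hH'2 : H' ≤ (r ^ 3) ^ 2 + (r ^ 3) ^ 4)
    (h : 0 ≤ c / 2 * H' + r ^ 2 * (r * s + 1 / 2 * (r ^ 2 * δ - r ^ 4 * β - r ^ 4 * γ) -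
      c / 2 * H) - r ^ 3 * P + 1 / 2 * (r ^ 6 * α)) :
    r * (P - s) + c / 2 * r ^ 2 ≤ 1 / 2 * (r ^ 2 * δ) + (2 * N + 2 * |c|) * r ^ 4 := by
  have hr2 : 0 < r ^ 2 := by positivity
  have hr6 : 0 ≤ r ^ 6 := by positivity
  have hN : 0 ≤ N := (abs_nonneg α).trans hα
  have a1 := (abs_le.1 hα).2
  have a2 := (abs_le.1 hβ).1
  have a3 := (abs_le.1 hγ).1
  have hpow : r ^ 12 ≤ r ^ 6 := pow_le_pow_of_le_one hr.le hr1 (by norm_num)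
  have hcH' : c * H' ≤ |c| * (2 * r ^ 6) :=
    (mul_le_mul_of_nonneg_right (le_abs_self c) ((sq_nonneg _).trans hH')).trans
      (mul_le_mul_of_nonneg_left (by linarith) (abs_nonneg c))
  have hcH : -c * (H - r ^ 2) ≤ |c| * r ^ 4 :=
    (mul_le_mul_of_nonneg_right (neg_le_abs c) (sub_nonneg.2 hH)).trans
      (mul_le_mul_of_nonneg_left (by linarith) (abs_nonneg c))
  have t1 := mul_le_mul_of_nonneg_left a1 hr6
  have t2 := mul_le_mul_of_nonneg_left a2 hr6
  have t3 := mul_le_mul_of_nonneg_left a3 hr6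
  have t4 : 0 ≤ r ^ 6 * N := mul_nonneg hr6 hN
  have t5 := mul_le_mul_of_nonneg_left hcH hr2.le
  have t6 : 0 ≤ r ^ 6 * |c| := mul_nonneg hr6 (abs_nonneg c)
  refine le_of_mul_le_mul_left ?_ hr2
  linarith

/-- Comparison on a small ball of radius `r`, whose centre is at distance `r³` from `x₀`. -/
theorem ComparisonAbove.exists_unit_of_le_quadratic {n : ℕ}
    {U : Set (EuclideanSpace ℝ (Fin n))} {u₁ u₂ : EuclideanSpace ℝ (Fin n) → ℝ}
    (h : ComparisonAbove U u₁ u₂) {x₀ p e : EuclideanSpace ℝ (Fin n)}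
    (he : ‖e‖ = 1) (hpe : inner ℝ p e = ‖p‖)
    {B : EuclideanSpace ℝ (Fin n) →L[ℝ] EuclideanSpace ℝ (Fin n) →L[ℝ] ℝ}
    {Q : EuclideanSpace ℝ (Fin n) → ℝ}
    (hQ : ∀ x, Q x = u₁ x₀ + inner ℝ p (x - x₀) + 1 / 2 * B (x - x₀) (x - x₀))
    {c r : ℝ} (hr : 0 < r) (hr1 : r ≤ 1) (hK : closedBall (x₀ - r ^ 3 • e) r ⊆ U)
    (h₁ : ∀ x ∈ closedBall (x₀ - r ^ 3 • e) r, u₁ x ≤ Q x)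
    (h₂ : ∀ x ∈ closedBall (x₀ - r ^ 3 • e) r, ∀ z ∈ closedBall (x₀ - r ^ 3 • e) r,
      u₂ x ≤ Q z - c ∧ u₂ x ≤ Q z - c * Real.cosh (Real.sqrt 2 * r)) :
    ∃ θ : EuclideanSpace ℝ (Fin n), ‖θ‖ = 1 ∧
      r * (‖p‖ - inner ℝ p θ) + c / 2 * r ^ 2 ≤
        1 / 2 * (r ^ 2 * B θ θ) + (2 * ‖B‖ + 2 * |c|) * r ^ 4 := by
  have : Nontrivial (EuclideanSpace ℝ (Fin n)) :=
    ⟨e, 0, norm_ne_zero_iff.1 (he ▸ one_ne_zero)⟩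
  have hr30 : 0 < r ^ 3 := by positivity
  have hrr : r ^ 3 ≤ r := pow_le_of_le_one hr.le hr1 (by norm_num)
  set y := x₀ - r ^ 3 • e with hy
  have hxy : ‖x₀ - y‖ = r ^ 3 := by
    rw [hy, sub_sub_cancel, norm_smul, he, mul_one, Real.norm_of_nonneg hr30.le]
  have hQc : Continuous Q := by
    rw [funext hQ]
    fun_prop
  obtain ⟨w, hw, hwmax⟩ := (isCompact_sphere y r).exists_isMaxOn
    (NormedSpace.sphere_nonempty.2 hr.le) hQc.continuousOn
  have hss := sphere_subset_closedBall (x := y) (ε := r)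
  have hyy := mem_closedBall_self (x := y) hr.le
  have key := h.le_of_sphere (c := c) (m := Q w) (q := Q y) hr hK (h₁ y hyy) (h₂ y hyy y hyy).1
    (fun x hx => (h₁ x (hss hx)).trans (isMaxOn_iff.1 hwmax x hx))
    (fun x hx => (h₂ x (hss hx) w (hss hw)).2)
    (x := x₀) (by rw [mem_closedBall_iff_norm, hxy]; exact hrr)
  obtain ⟨θ, hθ⟩ : ∃ θ, θ = r⁻¹ • (w - y) := ⟨_, rfl⟩
  have hθ1 : ‖θ‖ = 1 := by
    rw [hθ, norm_smul, mem_sphere_iff_norm.1 hw, norm_inv, Real.norm_of_nonneg hr.le,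
      inv_mul_cancel₀ hr.ne']
  have hwx : w - x₀ = r • θ - r ^ 3 • e := by
    rw [hθ, smul_inv_smul₀ hr.ne', hy]
    abel
  have hyx : y - x₀ = -(r ^ 3 • e) := by
    rw [hy]
    abel
  have hQy : Q y = u₁ x₀ - r ^ 3 * ‖p‖ + 1 / 2 * (r ^ 6 * B e e) := by
    rw [hQ, hyx]
    simp only [inner_neg_right, inner_smul_right, hpe, map_neg, map_smul, neg_apply, smul_apply,
      smul_eq_mul]
    ring
  have hQw : Q w - Q y = r * inner ℝ p θ +
      1 / 2 * (r ^ 2 * B θ θ - r ^ 4 * B θ e - r ^ 4 * B e θ) := by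
    rw [hQy, hQ, hwx]
    simp only [inner_sub_right, inner_smul_right, hpe, map_sub, map_smul, sub_apply, smul_apply,
      smul_eq_mul]
    ring
  have hB : ∀ a b : EuclideanSpace ℝ (Fin n), ‖a‖ = 1 → ‖b‖ = 1 → |B a b| ≤ ‖B‖ := by
    intro a b ha hb
    simpa [ha, hb] using B.le_opNorm₂ a b
  refine ⟨θ, hθ1, le_add_of_cone_estimate hr hr1 (hB e e he he) (hB θ e hθ1 he) (hB e θ he hθ1)
    (sq_le_cosh_sqrt_two_mul_sub_one hr.le) (cosh_sqrt_two_mul_sub_one_le hr.le hr1)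
    (sq_le_cosh_sqrt_two_mul_sub_one hr30.le)
    (cosh_sqrt_two_mul_sub_one_le hr30.le (hrr.trans hr1)) ?_⟩
  have hdiv : ∀ s : ℝ, s / r * r ^ 3 = r ^ 2 * s := fun s => by field_simp
  rw [hxy, hdiv, hQw, hQy] at key
  linarith

theorem exists_norm_eq_one_inner_eq_norm {n : ℕ} (hn : 1 ≤ n) (p : EuclideanSpace ℝ (Fin n)) :
    ∃ e : EuclideanSpace ℝ (Fin n), ‖e‖ = 1 ∧ inner ℝ p e = ‖p‖ := by
  have : Nonempty (Fin n) := ⟨⟨0, hn⟩⟩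
  by_cases hp : p = 0
  · obtain ⟨e, he⟩ := exists_norm_eq (EuclideanSpace ℝ (Fin n)) zero_le_one
    exact ⟨e, he, by simp [hp]⟩
  · have hp' : ‖p‖ ≠ 0 := norm_ne_zero_iff.2 hp
    refine ⟨‖p‖⁻¹ • p, by simp [norm_smul, hp'], ?_⟩
    rw [inner_smul_right, real_inner_self_eq_norm_sq]
    field_simp

theorem ComparisonAbove.eventually_exists_unit {n : ℕ} (hn : 1 ≤ n)
    {U : Set (EuclideanSpace ℝ (Fin n))}
    (hU : IsOpen U) {u₁ u₂ : EuclideanSpace ℝ (Fin n) → ℝ} (h : ComparisonAbove U u₁ u₂)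
    {x₀ : EuclideanSpace ℝ (Fin n)} (hx₀ : x₀ ∈ U) (hc₂ : ContinuousAt u₂ x₀)
    {p : EuclideanSpace ℝ (Fin n)}
    {B : EuclideanSpace ℝ (Fin n) →L[ℝ] EuclideanSpace ℝ (Fin n) →L[ℝ] ℝ}
    (hQ : ∀ᶠ x in 𝓝 x₀, u₁ x ≤ u₁ x₀ + inner ℝ p (x - x₀) + 1 / 2 * B (x - x₀) (x - x₀))
    {c : ℝ} (hc : c < u₁ x₀ - u₂ x₀) :
    ∀ᶠ r : ℝ in 𝓝[>] 0, ∃ θ : EuclideanSpace ℝ (Fin n), ‖θ‖ = 1 ∧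
      r * (‖p‖ - inner ℝ p θ) + c / 2 * r ^ 2 ≤
        1 / 2 * (r ^ 2 * B θ θ) + (2 * ‖B‖ + 2 * |c|) * r ^ 4 := by
  obtain ⟨e, he, hpe⟩ := exists_norm_eq_one_inner_eq_norm hn p
  obtain ⟨Q, hQdef⟩ : ∃ Q : EuclideanSpace ℝ (Fin n) → ℝ, ∀ x,
      Q x = u₁ x₀ + inner ℝ p (x - x₀) + 1 / 2 * B (x - x₀) (x - x₀) := ⟨_, fun _ => rfl⟩
  have hQc : Continuous Q := by
    rw [funext hQdef]
    fun_prop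
  have hQ₀ : Q x₀ = u₁ x₀ := by simp [hQdef]
  obtain ⟨ε, hε, hεc⟩ : ∃ ε : ℝ, 0 < ε ∧ u₂ x₀ + c + 4 * ε = u₁ x₀ :=
    ⟨(u₁ x₀ - u₂ x₀ - c) / 4, by linarith, by ring⟩
  have hev : ∀ᶠ x in 𝓝 x₀, u₁ x ≤ Q x ∧ u₂ x < u₂ x₀ + ε ∧ u₁ x₀ - ε < Q x ∧ x ∈ U :=
    (hQ.mono fun x hx => (hQdef x).symm ▸ hx).and ((hc₂.eventually_lt_const (by linarith)).and
      ((hQc.continuousAt.eventually_const_lt (by linarith)).and (hU.mem_nhds hx₀)))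
  obtain ⟨δ, hδ, hball⟩ := Metric.eventually_nhds_iff_ball.1 hev
  have hlim : ∀ᶠ r : ℝ in 𝓝[>] 0, c * Real.cosh (Real.sqrt 2 * r) < c + 2 * ε := by
    have hcont : Continuous fun r : ℝ => c * Real.cosh (Real.sqrt 2 * r) := by fun_prop
    refine nhdsWithin_le_nhds (hcont.continuousAt.eventually_lt_const ?_)
    simpa using hε
  filter_upwards [self_mem_nhdsWithin, hlim,
    nhdsWithin_le_nhds (eventually_lt_nhds (show (0 : ℝ) < δ / 2 by positivity)),
    nhdsWithin_le_nhds (eventually_lt_nhds (zero_lt_one' ℝ))] with r hr hr1 hr2 hr3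
  have hr : 0 < r := hr
  have hrr : r ^ 3 ≤ r := pow_le_of_le_one hr.le hr3.le (by norm_num)
  have hsub : closedBall (x₀ - r ^ 3 • e) r ⊆ ball x₀ δ := by
    refine closedBall_subset_ball' ?_
    rw [dist_comm, dist_eq_norm, sub_sub_cancel, norm_smul, he, mul_one,
      Real.norm_of_nonneg (by positivity)]
    linarith
  refine h.exists_unit_of_le_quadratic he hpe hQdef hr hr3.le
    (fun x hx => (hball x (hsub hx)).2.2.2) (fun x hx => (hball x (hsub hx)).1)
    fun x hx z hz => ?_
  have hx2 := (hball x (hsub hx)).2.1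
  have hz3 := (hball z (hsub hz)).2.2.1
  exact ⟨by linarith, by linarith⟩

theorem exists_unit_of_eventually_exists_unit {n : ℕ} (hn : 1 ≤ n) {p : EuclideanSpace ℝ (Fin n)}
    {B : EuclideanSpace ℝ (Fin n) →L[ℝ] EuclideanSpace ℝ (Fin n) →L[ℝ] ℝ} {c K : ℝ} (hK : 0 ≤ K)
    (h : ∀ᶠ r : ℝ in 𝓝[>] 0, ∃ θ : EuclideanSpace ℝ (Fin n), ‖θ‖ = 1 ∧
      r * (‖p‖ - inner ℝ p θ) + c / 2 * r ^ 2 ≤ 1 / 2 * (r ^ 2 * B θ θ) + K * r ^ 4) :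
    ∃ θ : EuclideanSpace ℝ (Fin n), ‖θ‖ = 1 ∧ inner ℝ p θ = ‖p‖ ∧ c ≤ B θ θ := by
  have : Nonempty (Fin n) := ⟨⟨0, hn⟩⟩
  obtain ⟨θ, hθ, hθmax⟩ := (isCompact_sphere (0 : EuclideanSpace ℝ (Fin n)) 1).exists_isMaxOn
    (NormedSpace.sphere_nonempty.2 zero_le_one)
    (f := fun θ => min (inner ℝ p θ - ‖p‖) (B θ θ - c)) (by fun_prop)
  have hθ1 : ‖θ‖ = 1 := by simpa using hθ
  have hle : ∀ v : EuclideanSpace ℝ (Fin n), ‖v‖ = 1 → inner ℝ p v ≤ ‖p‖ := fun v hv => by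
    simpa [hv] using real_inner_le_norm p v
  have hnn : 0 ≤ min (inner ℝ p θ - ‖p‖) (B θ θ - c) := by
    have hlim : Tendsto (fun r : ℝ => -((1 / 2 * ‖B‖ + |c|) * r + K * r ^ 3 + 2 * K * r ^ 2))
        (𝓝[>] 0) (𝓝 0) := by
      have hcont : Continuous fun r : ℝ =>
        -((1 / 2 * ‖B‖ + |c|) * r + K * r ^ 3 + 2 * K * r ^ 2) := by fun_prop
      simpa using (hcont.tendsto 0).mono_left nhdsWithin_le_nhds
    refine le_of_tendsto hlim ?_
    filter_upwards [h, self_mem_nhdsWithin] with r hr hr0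
    have hr0 : 0 < r := hr0
    obtain ⟨v, hv, hineq⟩ := hr
    refine le_trans ?_ (isMaxOn_iff.1 hθmax v (by simpa using hv))
    have hb : B v v ≤ ‖B‖ := by
      simpa [hv] using (le_abs_self _).trans (B.le_opNorm₂ v v)
    have hpv := hle v hv
    have hr2 : 0 < r ^ 2 := by positivity
    refine le_min ?_ ?_
    · have h1 : r * (‖p‖ - inner ℝ p v) ≤ r * ((1 / 2 * ‖B‖ + |c|) * r + K * r ^ 3) := by
        have h1 := mul_le_mul_of_nonneg_left hb hr2.le
        have h2 := mul_le_mul_of_nonneg_left (neg_abs_le c) hr2.le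
        have h3 := mul_nonneg hr2.le (abs_nonneg c)
        linarith
      have h2 := le_of_mul_le_mul_left h1 hr0
      have : 0 ≤ 2 * K * r ^ 2 := by positivity
      linarith
    · have h1 : r ^ 2 * (c - B v v) ≤ r ^ 2 * (2 * K * r ^ 2) := by
        have : 0 ≤ r * (‖p‖ - inner ℝ p v) := mul_nonneg hr0.le (by linarith)
        linarith
      have h2 := le_of_mul_le_mul_left h1 hr2
      have : 0 ≤ (1 / 2 * ‖B‖ + |c|) * r + K * r ^ 3 := by positivity
      linarith
  obtain ⟨hn1, hn2⟩ := le_min_iff.1 hnn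
  exact ⟨θ, hθ1, le_antisymm (hle θ hθ1) (by linarith), by linarith⟩

theorem secondDeriv_le_laplInfPlus {n : ℕ} {φ : EuclideanSpace ℝ (Fin n) → ℝ}
    {x θ : EuclideanSpace ℝ (Fin n)} (hθ : ‖θ‖ = 1)
    (hinner : inner ℝ (gradient φ x) θ = ‖gradient φ x‖) :
    secondDeriv φ x θ ≤ laplInfPlus φ x := by
  by_cases hg : gradient φ x = 0
  · rw [laplInfPlus, if_pos hg]
    refine le_csSup ⟨‖fderiv ℝ (fderiv ℝ φ) x‖, ?_⟩ ⟨θ, hθ, rfl⟩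
    rintro t ⟨v, hv, rfl⟩
    rw [secondDeriv_eq_fderiv]
    simpa [hv] using (le_abs_self _).trans ((fderiv ℝ (fderiv ℝ φ) x).le_opNorm₂ v v)
  · rw [laplInfPlus, if_neg hg]
    have hpos : ‖gradient φ x‖ ≠ 0 := norm_ne_zero_iff.2 hg
    have h := inner_eq_norm_mul_iff_real.1 (hinner.trans (by rw [hθ, mul_one]))
    rw [hθ, one_smul] at h
    have hsmul : ∀ t : ℝ, secondDeriv φ x (t • θ) = t ^ 2 * secondDeriv φ x θ := fun t => by
      simp only [secondDeriv_eq_fderiv, map_smul, smul_apply, smul_eq_mul]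
      ring
    have h2 := hsmul ‖gradient φ x‖
    rw [← h] at h2
    rw [h2, mul_div_cancel_left₀ _ (pow_ne_zero 2 hpos)]

theorem ComparisonAbove.subPair {n : ℕ} (hn : 1 ≤ n)
    {U : Set (EuclideanSpace ℝ (Fin n))} (hU : IsOpen U)
    {u₁ u₂ : EuclideanSpace ℝ (Fin n) → ℝ} (h : ComparisonAbove U u₁ u₂)
    (hu₂ : ContinuousOn u₂ U) : SubPair U u₁ u₂ := by
  intro φ hφ x₀ hx₀ hmax
  have hmax : IsLocalMax (fun x => u₁ x - φ x) x₀ := hmax.isLocalMax (hU.mem_nhds hx₀)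
  obtain ⟨I, hI⟩ : ∃ I : EuclideanSpace ℝ (Fin n) →L[ℝ] EuclideanSpace ℝ (Fin n) →L[ℝ] ℝ,
      ∀ v, I v v = ‖v‖ ^ 2 := ⟨innerSL ℝ, real_inner_self_eq_norm_sq⟩
  have key : ∀ η : ℝ, 0 < η → u₁ x₀ - u₂ x₀ - η - η ≤ laplInfPlus φ x₀ := by
    intro η hη
    have hB : ∀ v, (fderiv ℝ (fderiv ℝ φ) x₀ + η • I) v v =
        fderiv ℝ (fderiv ℝ φ) x₀ v v + η * ‖v‖ ^ 2 := fun v => by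
      simp only [add_apply, smul_apply, hI, smul_eq_mul]
    have hQ : ∀ᶠ x in 𝓝 x₀, u₁ x ≤ u₁ x₀ + inner ℝ (gradient φ x₀) (x - x₀) +
        1 / 2 * (fderiv ℝ (fderiv ℝ φ) x₀ + η • I) (x - x₀) (x - x₀) := by
      filter_upwards [hmax, hφ.contDiffAt.eventually_le_taylor_two hη] with x h1 h2
      rw [inner_gradient_left, hB]
      linarith
    obtain ⟨θ, hθ, hpθ, hle⟩ := exists_unit_of_eventually_exists_unit hn (by positivity)
      (h.eventually_exists_unit hn hU hx₀ (hu₂.continuousAt (hU.mem_nhds hx₀)) hQ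
        (c := u₁ x₀ - u₂ x₀ - η) (by linarith))
    have hle' := secondDeriv_le_laplInfPlus hθ hpθ
    rw [secondDeriv_eq_fderiv] at hle'
    rw [hB, hθ] at hle
    linarith
  by_contra! hcon
  linarith [key ((-laplInfPlus φ x₀ + u₁ x₀ - u₂ x₀) / 4) (by linarith)]

/-- Characterization of subsolutions (Theorem 4.1, subsolution part). -/
theorem subsolution_iff_comparisonAbove {n : ℕ} (hn : 1 ≤ n)
    {U : Set (EuclideanSpace ℝ (Fin n))} (hUo : IsOpen U) (hUb : Bornology.IsBounded U)
    {u₁ u₂ : EuclideanSpace ℝ (Fin n) → ℝ}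
    (hu₁ : ContinuousOn u₁ (closure U)) (hu₂ : ContinuousOn u₂ (closure U)) :
    IsSubsolution U u₁ u₂ ↔ ComparisonAbove U u₁ u₂ := by
  have c₁ := hu₁.mono subset_closure
  have c₂ := hu₂.mono subset_closure
  exact ⟨fun h => h.comparisonAbove hn c₁ c₂, fun h => ⟨c₁.upperSemicontinuousOn,
    c₂.upperSemicontinuousOn, h.subPair hn hUo c₂, h.symm.subPair hn hUo c₁⟩⟩
end
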